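/- arXiv:2302.09073 — 3 statements merged into one kernel-verified Lean document; each statement's English description precedes it below -/
import Mathlib

section
/- Under hypotheses (g1)–(g5) on a generalized N-function G over an open set Ω ⊆ ℝ^d, there exists a generalized N-function R̂(x,t) = ∫_0^{|t|} r̂(x,τ)dτ of one spatial variable satisfying: (1) there are constants r⁻, r⁺ with 1 < r⁻ ≤ r̂(x,t)t/R̂(x,t) ≤ r⁺ < g⁻*/g⁺ for all x ∈ Ω and t > 0; (2) condition (B_f): there are constants c₁, c₂ > 0 with c₁ ≤ R̂(x,1) ≤ c₂ for all x ∈ Ω; (3) R̂ ∘ Ĝ grows essentially more slowly than Ĝ*, i.e., for every k > 0 and every x ∈ Ω, lim_{t→∞} R̂(x, Ĝ(x,kt)) / Ĝ*(x,t) = 0. -/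
open MeasureTheory Filter Set Metric Topology
open scoped ENNReal NNReal

noncomputable section

abbrev Rd (d : ℕ) := EuclideanSpace ℝ (Fin d)

/-- Modular `J_Φ(u) = ∫_Ω Φ(x,|u(x)|) dx` for an x-dependent Young function `Φ`. -/
def modular {d : ℕ} (Ω : Set (Rd d)) (Φ : Rd d → ℝ → ℝ) (u : Rd d → ℝ) : ℝ≥0∞ :=
  ∫⁻ x in Ω, ENNReal.ofReal (Φ x |u x|)

/-- Luxemburg norm associated to the modular `J_Φ`. -/
def luxNorm {d : ℕ} (Ω : Set (Rd d)) (Φ : Rd d → ℝ → ℝ) (u : Rd d → ℝ) : ℝ :=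
  sInf {l : ℝ | 0 < l ∧ modular Ω Φ (fun x => u x / l) ≤ 1}

/-- Fractional modular `J_{s,G}(u) = ∬ G(x,y,(u(x)-u(y))/|x-y|^s) |x-y|^{-d} dx dy`. -/
def fracModular {d : ℕ} (Ω : Set (Rd d)) (s : ℝ) (G : Rd d → Rd d → ℝ → ℝ)
    (u : Rd d → ℝ) : ℝ≥0∞ :=
  ∫⁻ x in Ω, ∫⁻ y in Ω,
    ENNReal.ofReal (G x y ((u x - u y) / dist x y ^ s) / dist x y ^ (d : ℝ))

/-- `(s,G)`-Gagliardo seminorm. -/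
def gagliardo {d : ℕ} (Ω : Set (Rd d)) (s : ℝ) (G : Rd d → Rd d → ℝ → ℝ)
    (u : Rd d → ℝ) : ℝ :=
  sInf {l : ℝ | 0 < l ∧ fracModular Ω s G (fun x => u x / l) ≤ 1}

/-- `Ĝ(x,t) := G(x,x,t)`. -/
def hatG {d : ℕ} (G : Rd d → Rd d → ℝ → ℝ) : Rd d → ℝ → ℝ := fun x t => G x x t

/-- Membership in the fractional Musielak–Sobolev space `W^{s,G}(Ω)`. -/
def memW {d : ℕ} (Ω : Set (Rd d)) (s : ℝ) (G : Rd d → Rd d → ℝ → ℝ)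
    (u : Rd d → ℝ) : Prop :=
  Measurable u ∧ (∃ l, 0 < l ∧ modular Ω (hatG G) (fun x => u x / l) ≤ 1) ∧
    (∃ l, 0 < l ∧ fracModular Ω s G (fun x => u x / l) ≤ 1)

/-- Norm of `W^{s,G}(Ω)`. -/
def normW {d : ℕ} (Ω : Set (Rd d)) (s : ℝ) (G : Rd d → Rd d → ℝ → ℝ)
    (u : Rd d → ℝ) : ℝ :=
  luxNorm Ω (hatG G) u + gagliardo Ω s G u

/-- Hypotheses (g1)–(g4) for a generalized N-function `G` with density `g(x,y,t) = a(x,y,t)·t`. -/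
def GHyps (d : ℕ) (Ω : Set (Rd d)) (s : ℝ) (a g G : Rd d → Rd d → ℝ → ℝ)
    (gm gp : ℝ) : Prop :=
  2 ≤ d ∧ 0 < s ∧ s < 1 ∧ s * gm < (d : ℝ) ∧
  (∀ x ∈ Ω, ∀ y ∈ Ω, ∀ t : ℝ, 0 < t → 0 < a x y t) ∧
  (∀ x ∈ Ω, ∀ y ∈ Ω, ∀ t : ℝ, 0 < t → g x y t = a x y t * t) ∧
  (∀ x ∈ Ω, ∀ y ∈ Ω, g x y 0 = 0) ∧
  (∀ x ∈ Ω, ∀ y ∈ Ω, ∀ t : ℝ, g x y (-t) = -(g x y t)) ∧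
  (∀ x ∈ Ω, ∀ y ∈ Ω, ∀ t : ℝ, G x y t = ∫ τ in Ioc (0:ℝ) |t|, g x y τ) ∧
  (∀ x ∈ Ω, ∀ y ∈ Ω, Tendsto (fun t => a x y t * t) (𝓝[>] (0:ℝ)) (𝓝 0)) ∧
  (∀ x ∈ Ω, ∀ y ∈ Ω, Tendsto (fun t => a x y t * t) atTop atTop) ∧
  (∀ x ∈ Ω, ∀ y ∈ Ω, ContinuousOn (fun t => a x y t) (Ioi (0:ℝ))) ∧
  (∀ x ∈ Ω, ∀ y ∈ Ω, StrictMonoOn (fun t => a x y t * t) (Ioi (0:ℝ))) ∧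
  1 < gm ∧ gm ≤ gp ∧ gp < (d : ℝ) * gm / ((d : ℝ) - s * gm) ∧
  (∀ x ∈ Ω, ∀ y ∈ Ω, ∀ t : ℝ, 0 < t →
    gm ≤ a x y t * t ^ 2 / G x y t ∧ a x y t * t ^ 2 / G x y t ≤ gp)

/-- The fractional boundedness condition (B_f). -/
def Bf {d : ℕ} (Ω : Set (Rd d)) (G : Rd d → Rd d → ℝ → ℝ) : Prop :=
  ∃ C₁ C₂ : ℝ, 0 < C₁ ∧ ∀ x ∈ Ω, ∀ y ∈ Ω, C₁ ≤ G x y 1 ∧ G x y 1 ≤ C₂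

/-- Condition (g5): `Ginv x` is the inverse of `t ↦ Ĝ(x,t)` on `[0,∞)` and the
integrability/divergence conditions of the conjugation integral hold. -/
def G5Hyps (d : ℕ) (Ω : Set (Rd d)) (s : ℝ) (G : Rd d → Rd d → ℝ → ℝ)
    (Ginv : Rd d → ℝ → ℝ) : Prop :=
  (∀ x ∈ Ω, ∀ t : ℝ, 0 ≤ t → Ginv x (G x x t) = t) ∧
  (∀ x ∈ Ω, ∀ t : ℝ, 0 ≤ t → G x x (Ginv x t) = t) ∧
  (∀ x ∈ Ω, (∫⁻ τ in Ioc (0:ℝ) 1,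
      ENNReal.ofReal (Ginv x τ / τ ^ (((d : ℝ) + s) / (d : ℝ)))) < ⊤) ∧
  (∀ x ∈ Ω, (∫⁻ τ in Ioi (1:ℝ),
      ENNReal.ofReal (Ginv x τ / τ ^ (((d : ℝ) + s) / (d : ℝ)))) = ⊤)

/-- `Gstar x` is the Musielak–Sobolev conjugate of `Ĝ(x,·)`, characterized as the
(strictly monotone) inverse of `t ↦ ∫_0^t Ginv x τ · τ^{-(d+s)/d} dτ` on `[0,∞)`. -/
def GstarHyps (d : ℕ) (Ω : Set (Rd d)) (s : ℝ) (Ginv Gstar : Rd d → ℝ → ℝ) : Prop :=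
  (∀ x ∈ Ω, StrictMonoOn (Gstar x) (Ici (0:ℝ))) ∧
  (∀ x ∈ Ω, ∀ t : ℝ, 0 ≤ t →
    Gstar x (∫ τ in Ioc (0:ℝ) t, Ginv x τ / τ ^ (((d : ℝ) + s) / (d : ℝ))) = t)

/-- A generalized N-function of one spatial variable. -/
def GNF1 (d : ℕ) (Ω : Set (Rd d)) (A : Rd d → ℝ → ℝ) : Prop :=
  (∀ x ∈ Ω, ∀ t : ℝ, A x (-t) = A x t) ∧
  (∀ x ∈ Ω, Continuous (A x)) ∧
  (∀ x ∈ Ω, ConvexOn ℝ (univ : Set ℝ) (A x)) ∧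
  (∀ x ∈ Ω, StrictMonoOn (A x) (Ici (0:ℝ))) ∧
  (∀ x ∈ Ω, A x 0 = 0) ∧
  (∀ x ∈ Ω, ∀ t : ℝ, 0 < t → 0 < A x t) ∧
  (∀ x ∈ Ω, Tendsto (fun t => A x t / t) (𝓝[>] (0:ℝ)) (𝓝 0)) ∧
  (∀ x ∈ Ω, Tendsto (fun t => A x t / t) atTop atTop) ∧
  (∀ t : ℝ, Measurable fun x => A x t)

/-- Condition (B_f) for an N-function of one spatial variable. -/
def Bf1 {d : ℕ} (Ω : Set (Rd d)) (A : Rd d → ℝ → ℝ) : Prop :=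
  ∃ C₁ C₂ : ℝ, 0 < C₁ ∧ ∀ x ∈ Ω, C₁ ≤ A x 1 ∧ A x 1 ≤ C₂

/-- Growth condition `1 < ℓ ≤ A'(x,t)·t/A(x,t) ≤ m < ∞` with density `aA = A'`. -/
def AGrowth (d : ℕ) (Ω : Set (Rd d)) (A aA : Rd d → ℝ → ℝ) (ℓ m : ℝ) : Prop :=
  (∀ x ∈ Ω, ∀ t : ℝ, A x t = ∫ τ in Ioc (0:ℝ) |t|, aA x τ) ∧ 1 < ℓ ∧
  (∀ x ∈ Ω, ∀ t : ℝ, 0 < t → ℓ ≤ aA x t * t / A x t ∧ aA x t * t / A x t ≤ m)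

/-- `A ≺≺ B`: for every `k > 0`, `A(x,kt)/B(x,t) → 0` as `t → ∞`, uniformly in `x`. -/
def GrowsSlower {d : ℕ} (A B : Rd d → ℝ → ℝ) : Prop :=
  ∀ k : ℝ, 0 < k → ∀ ε : ℝ, 0 < ε → ∃ T : ℝ, ∀ t : ℝ, T ≤ t → ∀ x : Rd d,
    A x (k * t) ≤ ε * B x t

/-- `lim_{t→0} A(x,t)/G(x,x,t) = 0` uniformly in `x`. -/
def LimZero {d : ℕ} (A : Rd d → ℝ → ℝ) (G : Rd d → Rd d → ℝ → ℝ) : Prop :=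
  ∀ ε : ℝ, 0 < ε → ∃ δ : ℝ, 0 < δ ∧ ∀ t : ℝ, 0 < t → t ≤ δ → ∀ x : Rd d,
    A x t ≤ ε * G x x t

/-- Hypotheses (V1)–(V2) on the potential `V`. -/
def VHyps {d : ℕ} (V : Rd d → ℝ) (V₀ : ℝ) : Prop :=
  Measurable V ∧ 0 < V₀ ∧ (∀ x, V₀ ≤ V x) ∧
  ∀ L : ℝ, 0 < L → volume {x : Rd d | V x < L} < ⊤

/-- Weighted modular `∫ V(x) Ĝ(x,|u(x)|) dx`. -/
def wModular {d : ℕ} (G : Rd d → Rd d → ℝ → ℝ) (V : Rd d → ℝ) (u : Rd d → ℝ) : ℝ≥0∞ :=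
  ∫⁻ x, ENNReal.ofReal (V x * G x x |u x|)

/-- Weighted Luxemburg norm `‖u‖_(E)`. -/
def wNorm {d : ℕ} (G : Rd d → Rd d → ℝ → ℝ) (V : Rd d → ℝ) (u : Rd d → ℝ) : ℝ :=
  sInf {l : ℝ | 0 < l ∧ wModular G V (fun x => u x / l) ≤ 1}

/-- Membership in the weighted space `E`. -/
def memE {d : ℕ} (s : ℝ) (G : Rd d → Rd d → ℝ → ℝ) (V : Rd d → ℝ)
    (u : Rd d → ℝ) : Prop :=
  memW univ s G u ∧ wModular G V u < ⊤

/-- Norm of the weighted space `E`: `‖u‖_E = [u]_{s,G} + ‖u‖_(E)`. -/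
def normE {d : ℕ} (s : ℝ) (G : Rd d → Rd d → ℝ → ℝ) (V : Rd d → ℝ)
    (u : Rd d → ℝ) : ℝ :=
  gagliardo univ s G u + wNorm G V u

/-- The modular `ρ(u) = J_Ĝ(u) + J_{s,G}(u)`. -/
def rhoMod {d : ℕ} (Ω : Set (Rd d)) (s : ℝ) (G : Rd d → Rd d → ℝ → ℝ)
    (u : Rd d → ℝ) : ℝ≥0∞ :=
  modular Ω (hatG G) u + fracModular Ω s G u

/-- The norm `‖u‖_(Ω)` associated to the modular `ρ`. -/
def rhoNorm {d : ℕ} (Ω : Set (Rd d)) (s : ℝ) (G : Rd d → Rd d → ℝ → ℝ)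
    (u : Rd d → ℝ) : ℝ :=
  sInf {l : ℝ | 0 < l ∧ rhoMod Ω s G (fun x => u x / l) ≤ 1}

/-- The complementary (conjugate) function `Φ̃(x,t) = sup_{τ ≥ 0} (tτ - Φ(x,τ))`. -/
def conjFn {d : ℕ} (Φ : Rd d → ℝ → ℝ) (x : Rd d) (t : ℝ) : ℝ :=
  sSup ((fun τ => t * τ - Φ x τ) '' Ici (0:ℝ))

lemma aux_G (gm gp : ℝ) (a g G : ℝ → ℝ) (hgm : 1 < gm)
    (ha : ∀ t, 0 < t → 0 < a t) (hg : ∀ t, 0 < t → g t = a t * t)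
    (hGi : ∀ t, G t = ∫ τ in Ioc (0:ℝ) |t|, g τ)
    (hc : ContinuousOn a (Ioi (0:ℝ)))
    (hb : ∀ t, 0 < t → gm ≤ a t * t ^ 2 / G t ∧ a t * t ^ 2 / G t ≤ gp) :
    0 < G 1 ∧ ∀ t, 1 ≤ t → G 1 * t ^ gm ≤ G t ∧ G t ≤ G 1 * t ^ gp := by
  have hpos : ∀ t, 0 < t → 0 < G t := by
    intro t ht
    by_contra h
    push Not at h
    have h1 := (hb t ht).1
    have : a t * t ^ 2 / G t ≤ 0 :=
      div_nonpos_of_nonneg_of_nonpos (mul_nonneg (ha t ht).le (sq_nonneg _)) h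
    linarith
  have hint : ∀ t, 0 < t → IntervalIntegrable g volume 0 t := by
    intro t ht
    rw [intervalIntegrable_iff_integrableOn_Ioc_of_le ht.le]
    by_contra h
    have := hpos t ht
    rw [hGi, abs_of_pos ht, integral_undef h] at this
    exact lt_irrefl _ this
  have hgc : ContinuousOn g (Ioi 0) := by
    have : ContinuousOn (fun t => a t * t) (Ioi 0) := hc.mul continuousOn_id
    exact this.congr (fun t ht => hg t ht)
  have hder : ∀ t, 0 < t → HasDerivAt G (g t) t := by
    intro t ht
    have h1 : HasDerivAt (fun u => ∫ τ in (0:ℝ)..u, g τ) (g t) t := by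
      apply intervalIntegral.integral_hasDerivAt_right (hint t ht)
      · exact hgc.stronglyMeasurableAtFilter isOpen_Ioi t ht
      · exact hgc.continuousAt (Ioi_mem_nhds ht)
    apply h1.congr_of_eventuallyEq
    filter_upwards [Ioi_mem_nhds ht] with u hu
    rw [hGi, abs_of_pos hu, intervalIntegral.integral_of_le (le_of_lt hu)]
  have hlog : ∀ p t, 0 < t → HasDerivAt (fun t => Real.log (G t) - p * Real.log t)
      ((a t * t ^ 2 / G t - p) / t) t := by
    intro p t ht
    have h := ((hder t ht).log (hpos t ht).ne').sub ((Real.hasDerivAt_log ht.ne').const_mul p)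
    have h0 : (a t * t ^ 2 / G t - p) / t = g t / G t - p * t⁻¹ := by
      rw [hg t ht]
      have := hpos t ht
      field_simp
    rw [h0]
    exact h
  refine ⟨hpos 1 one_pos, fun t ht => ?_⟩
  have ht0 : 0 < t := by linarith
  have key : ∀ p, Real.exp (p * Real.log t) = t ^ p := by
    intro p; rw [Real.rpow_def_of_pos ht0, mul_comm]
  constructor
  · have hm : MonotoneOn (fun t => Real.log (G t) - gm * Real.log t) (Ioi 0) := by
      apply monotoneOn_of_deriv_nonneg (convex_Ioi 0)
      · exact fun t ht => (hlog gm t ht).continuousAt.continuousWithinAt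
      · rw [interior_Ioi]
        exact fun t ht => (hlog gm t ht).differentiableAt.differentiableWithinAt
      · rw [interior_Ioi]
        intro t ht
        rw [(hlog gm t ht).deriv]
        exact div_nonneg (by linarith [(hb t ht).1]) (le_of_lt ht)
    have h := hm (show (1:ℝ) ∈ Ioi 0 by simp) (show t ∈ Ioi 0 from ht0) ht
    simp only [Real.log_one, mul_zero, sub_zero] at h
    have h2 : Real.exp (Real.log (G 1) + gm * Real.log t) ≤ Real.exp (Real.log (G t)) :=
      Real.exp_le_exp.2 (by linarith)
    rwa [Real.exp_add, Real.exp_log (hpos 1 one_pos), Real.exp_log (hpos t ht0), key] at h2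
  · have hm : AntitoneOn (fun t => Real.log (G t) - gp * Real.log t) (Ioi 0) := by
      apply antitoneOn_of_deriv_nonpos (convex_Ioi 0)
      · exact fun t ht => (hlog gp t ht).continuousAt.continuousWithinAt
      · rw [interior_Ioi]
        exact fun t ht => (hlog gp t ht).differentiableAt.differentiableWithinAt
      · rw [interior_Ioi]
        intro t ht
        rw [(hlog gp t ht).deriv]
        exact div_nonpos_of_nonpos_of_nonneg (by linarith [(hb t ht).2]) (le_of_lt ht)
    have h := hm (show (1:ℝ) ∈ Ioi 0 by simp) (show t ∈ Ioi 0 from ht0) ht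
    simp only [Real.log_one, mul_zero, sub_zero] at h
    have h2 : Real.exp (Real.log (G t)) ≤ Real.exp (Real.log (G 1) + gp * Real.log t) :=
      Real.exp_le_exp.2 (by linarith)
    rwa [Real.exp_add, Real.exp_log (hpos 1 one_pos), Real.exp_log (hpos t ht0), key] at h2

lemma aux_star (gm e β : ℝ) (G Gi Gs : ℝ → ℝ) (hgm : 1 < gm) (hβ : 0 < β)
    (he : 1 / gm - e = β - 1)
    (hG1 : 0 < G 1) (hG : ∀ t, 1 ≤ t → G 1 * t ^ gm ≤ G t)
    (hev : ∀ t, G |t| = G t)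
    (h1 : ∀ t, 0 ≤ t → Gi (G t) = t) (h2 : ∀ t, 0 ≤ t → G (Gi t) = t)
    (hmono : StrictMonoOn Gs (Ici 0))
    (hs : ∀ t, 0 ≤ t → Gs (∫ τ in Ioc (0:ℝ) t, Gi τ / τ ^ e) = t) :
    ∃ D, 0 < D ∧ ∀ t, D ≤ t → (t / D) ^ (1 / β) ≤ Gs t := by
  have hGi0 : ∀ t, 0 ≤ t → 0 ≤ Gi t := by
    intro t ht
    have h3 := h1 |Gi t| (abs_nonneg _)
    rw [hev, h2 t ht] at h3
    rw [h3]; exact abs_nonneg _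
  have hgi : 0 < 1 / gm := by positivity
  set C : ℝ := 1 + (1 / G 1) ^ (1 / gm) with hC
  have hC0 : 0 ≤ (1 / G 1) ^ (1 / gm) := by positivity
  have hGib : ∀ t, 1 ≤ t → Gi t ≤ C * t ^ (1 / gm) := by
    intro t ht
    have ht1 : 1 ≤ t ^ (1 / gm) := Real.one_le_rpow ht hgi.le
    rcases le_or_gt 1 (Gi t) with hv | hv
    · have h3 := hG _ hv
      rw [h2 t (by linarith)] at h3
      have h4 : (Gi t) ^ gm ≤ 1 / G 1 * t := by
        rw [one_div, ← div_eq_inv_mul, le_div_iff₀ hG1]; linarith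
      have h5 := Real.rpow_le_rpow (by have := hGi0 t (by linarith); positivity) h4 hgi.le
      rw [← Real.rpow_mul (hGi0 t (by linarith)), mul_one_div_cancel (by positivity), Real.rpow_one,
        Real.mul_rpow (by positivity) (by linarith)] at h5
      nlinarith
    · nlinarith
  set f : ℝ → ℝ := fun τ => Gi τ / τ ^ e with hf
  set A := ∫ τ in Ioc (0:ℝ) 1, f τ with hA
  set D := |A| + C / β with hD
  have hCp : 0 < C := by linarith
  have hDp : 0 < D := by positivity
  have hf0 : ∀ τ, 0 < τ → 0 ≤ f τ := by
    intro τ hτ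
    exact div_nonneg (hGi0 τ hτ.le) (by positivity)
  have hH : ∀ u, 1 ≤ u → ∫ τ in Ioc (0:ℝ) u, f τ ≤ D * u ^ β := by
    intro u hu
    have hu0 : 0 < u := by linarith
    by_cases hi : IntegrableOn f (Ioc 0 u)
    · have hun : Ioc (0:ℝ) u = Ioc 0 1 ∪ Ioc 1 u := (Ioc_union_Ioc_eq_Ioc zero_le_one hu).symm
      rw [hun, setIntegral_union (Ioc_disjoint_Ioc_of_le le_rfl) measurableSet_Ioc
        (hi.mono_set (Ioc_subset_Ioc_right hu)) (hi.mono_set (Ioc_subset_Ioc_left zero_le_one))]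
      have hcont : IntervalIntegrable (fun τ : ℝ => C * τ ^ (β - 1)) volume 1 u :=
        (intervalIntegral.intervalIntegrable_rpow' (by linarith)).const_mul C
      have h3 : ∫ τ in Ioc (1:ℝ) u, f τ ≤ ∫ τ in Ioc (1:ℝ) u, C * τ ^ (β - 1) := by
        apply setIntegral_mono_on (hi.mono_set (Ioc_subset_Ioc_left zero_le_one))
          ((intervalIntegrable_iff_integrableOn_Ioc_of_le hu).1 hcont) measurableSet_Ioc
        intro τ hτ
        have hτ0 : 0 < τ := by linarith [hτ.1]
        rw [← he, Real.rpow_sub hτ0, ← mul_div_assoc]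
        exact div_le_div_of_nonneg_right (hGib τ hτ.1.le) (by positivity)
      rw [← intervalIntegral.integral_of_le hu (f := fun τ => C * τ ^ (β - 1)),
        intervalIntegral.integral_const_mul, integral_rpow (Or.inl (by linarith)),
        sub_add_cancel, Real.one_rpow] at h3
      have h4 : 1 ≤ u ^ β := Real.one_le_rpow hu hβ.le
      have h5 : C * ((u ^ β - 1) / β) = C / β * u ^ β - C / β := by ring
      have h6 : 0 < C / β := by positivity
      have h7 := le_abs_self A
      have h8 : |A| ≤ |A| * u ^ β := le_mul_of_one_le_right (abs_nonneg _) h4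
      rw [hD, add_mul]
      linarith
    · rw [integral_undef hi]; positivity
  refine ⟨D, hDp, fun t ht => ?_⟩
  have htD : 1 ≤ t / D := by rwa [one_le_div hDp]
  set u := (t / D) ^ (1 / β) with hu
  have hu1 : 1 ≤ u := Real.one_le_rpow htD (by positivity)
  have h3 := hH u hu1
  have h4 : D * u ^ β = t := by
    rw [hu, ← Real.rpow_mul (by linarith), one_div_mul_cancel hβ.ne', Real.rpow_one]
    field_simp
  rw [h4] at h3
  have h5 : 0 ≤ ∫ τ in Ioc (0:ℝ) u, f τ :=
    setIntegral_nonneg measurableSet_Ioc fun τ hτ => hf0 τ hτ.1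
  have h6 := hmono.monotoneOn (show _ ∈ Ici (0:ℝ) from h5) (show t ∈ Ici (0:ℝ) from h5.trans h3) h3
  rwa [hs u (by linarith)] at h6

lemma aux_R (d : ℕ) (Ω : Set (Rd d)) (r : ℝ) (hr : 1 < r) :
    GNF1 d Ω (fun _ t => |t| ^ r) := by
  have hr0 : 0 < r := by linarith
  have hq : ∀ t : ℝ, 0 < t → |t| ^ r / t = t ^ (r - 1) := by
    intro t ht
    rw [abs_of_pos ht, Real.rpow_sub_one ht.ne']
  refine ⟨fun x _ t => by simp, fun x _ => continuous_abs.rpow_const (fun _ => Or.inr hr0.le),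
    fun x _ => ?_, fun x _ => ?_, fun x _ => ?_, fun x _ t ht => ?_, fun x _ => ?_, fun x _ => ?_,
    fun t => measurable_const⟩
  · refine ⟨convex_univ, fun x _ y _ p q hp hq hpq => ?_⟩
    simp only [smul_eq_mul]
    have h := (convexOn_rpow hr.le).2 (abs_nonneg x) (abs_nonneg y) hp hq hpq
    simp only [smul_eq_mul] at h
    refine le_trans (Real.rpow_le_rpow (abs_nonneg _) ?_ hr0.le) h
    calc |p * x + q * y| ≤ |p * x| + |q * y| := abs_add_le _ _
      _ = _ := by rw [abs_mul, abs_mul, abs_of_nonneg hp, abs_of_nonneg hq]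
  · intro u hu v hv huv
    simp only [abs_of_nonneg (show 0 ≤ u from hu), abs_of_nonneg (show 0 ≤ v from hv)]
    exact Real.rpow_lt_rpow hu huv hr0
  · simp [hr0.ne']
  · have := abs_pos.2 ht.ne'
    positivity
  · have h : Tendsto (fun t : ℝ => t ^ (r - 1)) (𝓝[>] 0) (𝓝 0) := by
      have := (Real.continuousAt_rpow_const 0 (r - 1) (Or.inr (by linarith))).tendsto
      rw [Real.zero_rpow (by linarith)] at this
      exact this.mono_left nhdsWithin_le_nhds
    refine h.congr' ?_
    filter_upwards [self_mem_nhdsWithin] with t ht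
    exact (hq t ht).symm
  · refine (tendsto_rpow_atTop (show 0 < r - 1 by linarith)).congr' ?_
    filter_upwards [eventually_gt_atTop 0] with t ht
    exact (hq t ht).symm

/-- Lemma 2.13: existence of a generalized N-function `R̂` of one
spatial variable with `1 < r⁻ ≤ r̂(x,t)t/R̂(x,t) ≤ r⁺ < g⁻*/g⁺`, satisfying (B_f),
and such that `R̂ ∘ Ĝ` grows essentially more slowly than `Ĝ*`. -/
theorem exists_R_hat
    (d : ℕ) (Ω : Set (Rd d)) (hΩ : IsOpen Ω) (s : ℝ)
    (a g G : Rd d → Rd d → ℝ → ℝ) (gm gp : ℝ)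
    (Ginv Gstar : Rd d → ℝ → ℝ)
    (hG : GHyps d Ω s a g G gm gp)
    (hg5 : G5Hyps d Ω s G Ginv)
    (hstar : GstarHyps d Ω s Ginv Gstar) :
    ∃ (R rr : Rd d → ℝ → ℝ) (rm rp c₁ c₂ : ℝ),
      GNF1 d Ω R ∧
      (∀ x ∈ Ω, ∀ t : ℝ, R x t = ∫ τ in Ioc (0:ℝ) |t|, rr x τ) ∧
      1 < rm ∧ rp < ((d : ℝ) * gm / ((d : ℝ) - s * gm)) / gp ∧
      (∀ x ∈ Ω, ∀ t : ℝ, 0 < t →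
        rm ≤ rr x t * t / R x t ∧ rr x t * t / R x t ≤ rp) ∧
      0 < c₁ ∧ (∀ x ∈ Ω, c₁ ≤ R x 1 ∧ R x 1 ≤ c₂) ∧
      (∀ k : ℝ, 0 < k → ∀ x ∈ Ω,
        Tendsto (fun t => R x (G x x (k * t)) / Gstar x t) atTop (𝓝 0)) := by
  obtain ⟨hd, hs0, hs1, hsg, ha, hg, -, -, hGi, -, -, hc, -, hgm, hgmp, hgp, hb⟩ := hG
  obtain ⟨hi1, hi2, -, -⟩ := hg5
  obtain ⟨hmono, hst⟩ := hstar
  have hd0 : (0:ℝ) < d := by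
    have : (2:ℝ) ≤ d := by exact_mod_cast hd
    linarith
  have hgm0 : 0 < gm := by linarith
  have hgp0 : 0 < gp := by linarith
  have hds : 0 < (d:ℝ) - s * gm := by linarith
  set q := (d : ℝ) * gm / ((d : ℝ) - s * gm) with hq
  have hq0 : 0 < q := by positivity
  have hqg : 1 < q / gp := by rwa [one_lt_div hgp0]
  obtain ⟨r, hr1, hr2⟩ := exists_between hqg
  have hr0 : 0 < r := by linarith
  refine ⟨fun _ t => |t| ^ r, fun _ t => r * t ^ (r - 1), r, r, 1, 1, aux_R d Ω r hr1, ?_, hr1, hr2,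
    ?_, one_pos, ?_, ?_⟩
  · intro x _ t
    simp only
    rw [← intervalIntegral.integral_of_le (abs_nonneg t), intervalIntegral.integral_const_mul,
      integral_rpow (Or.inl (by linarith)), sub_add_cancel, Real.zero_rpow hr0.ne', sub_zero]
    field_simp
  · intro x _ t ht
    have : r * t ^ (r - 1) * t / |t| ^ r = r := by
      rw [abs_of_pos ht, Real.rpow_sub_one ht.ne']
      have : 0 < t ^ r := by positivity
      field_simp
    exact ⟨this.ge, this.le⟩
  · intro x _
    simp
  · intro k hk x hx
    obtain ⟨hG1, hGb⟩ := aux_G gm gp (a x x) (g x x) (G x x) hgm (ha x hx x hx) (hg x hx x hx)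
      (hGi x hx x hx) (hc x hx x hx) (hb x hx x hx)
    have hev : ∀ t, G x x |t| = G x x t := fun t => by
      rw [hGi x hx x hx, hGi x hx x hx, abs_abs]
    have hqi : 1 / (1 / q) = q := by simp
    obtain ⟨D, hD, hDb⟩ := aux_star gm (((d : ℝ) + s) / (d : ℝ)) (1 / q) (G x x) (Ginv x) (Gstar x)
      hgm (by positivity) (by rw [hq]; field_simp; ring) hG1 (fun t ht => (hGb t ht).1) hev
      (hi1 x hx) (hi2 x hx) (hmono x hx) (hst x hx)
    rw [hqi] at hDb
    have hneg : 0 < q - gp * r := by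
      rw [lt_div_iff₀ hgp0] at hr2
      linarith
    have hlim : Tendsto (fun t : ℝ => ((G x x 1 * k ^ gp) ^ r * D ^ q) * t ^ (-(q - gp * r)))
        atTop (𝓝 0) := by
      simpa using (tendsto_rpow_neg_atTop hneg).const_mul ((G x x 1 * k ^ gp) ^ r * D ^ q)
    refine squeeze_zero' ?_ ?_ hlim
    · filter_upwards [eventually_ge_atTop D] with t ht
      have ht0 : 0 < t := by linarith
      have h1 := hDb t ht
      have h2 : 0 < (t / D) ^ q := by positivity
      have h3 : 0 < Gstar x t := by linarith
      positivity
    · filter_upwards [eventually_ge_atTop D, eventually_ge_atTop (1 / k)] with t ht htk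
      have ht0 : 0 < t := by linarith
      have h1 := hDb t ht
      have h2 : 0 < (t / D) ^ q := by positivity
      have hkt : 1 ≤ k * t := by
        rw [div_le_iff₀ hk] at htk
        linarith
      have h4 := hGb (k * t) hkt
      have h5 : 0 ≤ G x x (k * t) := le_trans (by positivity) h4.1
      rw [abs_of_nonneg h5]
      have h6 := Real.rpow_le_rpow h5 h4.2 hr0.le
      refine (div_le_div₀ (by positivity) h6 h2 h1).trans (le_of_eq ?_)
      rw [Real.mul_rpow hk.le ht0.le, ← mul_assoc, Real.mul_rpow (by positivity) (by positivity),
        Real.div_rpow ht0.le hD.le, ← Real.rpow_mul ht0.le, neg_sub, Real.rpow_sub ht0]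
      have : 0 < t ^ q := by positivity
      have : 0 < D ^ q := by positivity
      field_simp
end
end

section
/- (Uniform tail smallness for bounded sequences in the weighted space.) Under hypotheses (g1)–(g5), (B_f), (V1) and (V2), if (u_n) ⊂ E satisfies sup_n ‖u_n‖_E < ∞, then for every ε > 0 there exists r_ε > 0 such that ∫_{{|x| > r_ε}} Ĝ(x,|u_n(x)|)dx < ε for all sufficiently large n. -/
open MeasureTheory Filter Set Metric Topology
open scoped ENNReal NNReal

noncomputable section

lemma aux_oneVar (g G : ℝ → ℝ) (gm gp : ℝ) (hgc : ContinuousOn g (Ioi 0))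
    (hG : ∀ t, G t = ∫ τ in Ioc (0:ℝ) |t|, g τ) (hpos : ∀ t, 0 < t → 0 < G t)
    (h1 : ∀ t, 0 < t → gm * G t ≤ g t * t) (h2 : ∀ t, 0 < t → g t * t ≤ gp * G t) :
    ∀ t k, 0 < t → 1 ≤ k → k ^ gm * G t ≤ G (k * t) ∧ G (k * t) ≤ k ^ gp * G t := by
  have hint : ∀ t, 0 < t → IntervalIntegrable g volume 0 t := by
    intro t ht
    rw [intervalIntegrable_iff_integrableOn_Ioc_of_le ht.le]
    by_contra hcon
    have := hpos t ht
    rw [hG, abs_of_pos ht, integral_undef hcon] at this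
    exact lt_irrefl _ this
  have hder : ∀ t, 0 < t → HasDerivAt G (g t) t := by
    intro t ht
    have hc : ContinuousAt g t := hgc.continuousAt (Ioi_mem_nhds ht)
    have h3 : HasDerivAt (fun u => ∫ τ in (0:ℝ)..u, g τ) (g t) t := by
      apply intervalIntegral.integral_hasDerivAt_right (hint t ht) _ hc
      exact hgc.stronglyMeasurableAtFilter isOpen_Ioi t ht
    refine h3.congr_of_eventuallyEq ?_
    filter_upwards [Ioi_mem_nhds ht] with u hu
    have hu' : (0:ℝ) < u := hu
    rw [hG, abs_of_pos hu', intervalIntegral.integral_of_le hu'.le]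
  have hdq : ∀ q t, 0 < t → HasDerivAt (fun t => G t * t ^ (-q))
      (g t * t ^ (-q) + G t * (-q * t ^ (-q - 1))) t := by
    intro q t ht
    exact (hder t ht).mul (Real.hasDerivAt_rpow_const (Or.inl ht.ne'))
  have heq : ∀ q t, 0 < t → g t * t ^ (-q) + G t * (-q * t ^ (-q - 1))
      = (g t * t - q * G t) * t ^ (-q - 1) := by
    intro q t ht
    have : t ^ (-q) = t ^ (-q - 1) * t := by
      rw [← Real.rpow_add_one ht.ne']; ring_nf
    rw [this]; ring
  have hmono : MonotoneOn (fun t => G t * t ^ (-gm)) (Ioi 0) := by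
    apply monotoneOn_of_deriv_nonneg (convex_Ioi 0)
    · intro t ht; exact (hdq gm t ht).continuousAt.continuousWithinAt
    · rw [interior_Ioi]; intro t ht
      exact (hdq gm t ht).differentiableAt.differentiableWithinAt
    · rw [interior_Ioi]; intro t ht
      have ht' : (0:ℝ) < t := ht
      rw [(hdq gm t ht').deriv, heq gm t ht']
      exact mul_nonneg (by linarith [h1 t ht']) (Real.rpow_nonneg ht'.le _)
  have hanti : AntitoneOn (fun t => G t * t ^ (-gp)) (Ioi 0) := by
    apply antitoneOn_of_deriv_nonpos (convex_Ioi 0)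
    · intro t ht; exact (hdq gp t ht).continuousAt.continuousWithinAt
    · rw [interior_Ioi]; intro t ht
      exact (hdq gp t ht).differentiableAt.differentiableWithinAt
    · rw [interior_Ioi]; intro t ht
      have ht' : (0:ℝ) < t := ht
      rw [(hdq gp t ht').deriv, heq gp t ht']
      exact mul_nonpos_of_nonpos_of_nonneg (by linarith [h2 t ht']) (Real.rpow_nonneg ht'.le _)
  intro t k ht hk
  have hk0 : 0 < k := by linarith
  have hkt : 0 < k * t := by positivity
  have hle : t ≤ k * t := by nlinarith
  have e1 := hmono (show t ∈ Ioi 0 from ht) (show k * t ∈ Ioi 0 from hkt) hle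
  have e2 := hanti (show t ∈ Ioi 0 from ht) (show k * t ∈ Ioi 0 from hkt) hle
  simp only at e1 e2
  rw [Real.mul_rpow hk0.le ht.le] at e1 e2
  have p1 : 0 < t ^ (-gm) := Real.rpow_pos_of_pos ht _
  have p2 : 0 < t ^ (-gp) := Real.rpow_pos_of_pos ht _
  have r1 : k ^ gm * k ^ (-gm) = 1 := by rw [← Real.rpow_add hk0]; simp
  have r2 : k ^ gp * k ^ (-gp) = 1 := by rw [← Real.rpow_add hk0]; simp
  have q1 : 0 < k ^ gm := Real.rpow_pos_of_pos hk0 _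
  have q2 : 0 < k ^ gp := Real.rpow_pos_of_pos hk0 _
  constructor
  · have : G t ≤ G (k * t) * k ^ (-gm) := le_of_mul_le_mul_right (by linarith) p1
    calc k ^ gm * G t ≤ k ^ gm * (G (k * t) * k ^ (-gm)) := by gcongr
      _ = G (k * t) * (k ^ gm * k ^ (-gm)) := by ring
      _ = _ := by rw [r1, mul_one]
  · have : G (k * t) * k ^ (-gp) ≤ G t := le_of_mul_le_mul_right (by linarith) p2
    calc G (k * t) = G (k * t) * (k ^ gp * k ^ (-gp)) := by rw [r2, mul_one]
      _ = k ^ gp * (G (k * t) * k ^ (-gp)) := by ring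
      _ ≤ _ := by gcongr

/-- uniform weak-type decay of super-level sets over a class `P` -/
def Decay {d : ℕ} (P : (Rd d → ℝ) → Prop) (q : ℝ) : Prop :=
  ∃ B : ℝ, 0 < B ∧ ∃ Λ : ℝ, 1 ≤ Λ ∧ ∀ v, P v → ∀ t, Λ ≤ t →
    volume {x : Rd d | t ≤ |v x|} ≤ ENNReal.ofReal (B * t ^ (-q))

lemma decay_tail {d : ℕ} (P : (Rd d → ℝ) → Prop) (hPm : ∀ v, P v → Measurable v)
    (q p : ℝ) (hp : 0 < p) (hq : p < q) (hD : Decay P q) (ε : ℝ) (hε : 0 < ε) :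
    ∃ K : ℝ, 1 ≤ K ∧ ∀ v, P v →
      ∫⁻ x in {x : Rd d | K ≤ |v x|}, ENNReal.ofReal (|v x| ^ p) ≤ ENNReal.ofReal ε := by
  obtain ⟨B, hB, Λ, hΛ, h⟩ := hD
  set r : ℝ := 2 ^ (p - q) with hr
  have hr0 : 0 < r := by positivity
  have hr1 : r < 1 := Real.rpow_lt_one_of_one_lt_of_neg (by norm_num) (by linarith)
  have hlim : Tendsto (fun m : ℕ => B * 2 ^ p * r ^ m * (1 - r)⁻¹) atTop (𝓝 0) := by
    have := ((tendsto_pow_atTop_nhds_zero_of_lt_one hr0.le hr1).const_mul (B * 2 ^ p)).mul_const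
      (1 - r)⁻¹
    simpa using this
  have hlim2 : Tendsto (fun m : ℕ => (2:ℝ) ^ m) atTop atTop :=
    tendsto_pow_atTop_atTop_of_one_lt (by norm_num)
  obtain ⟨m, hm1, hm2⟩ := ((hlim.eventually (eventually_le_nhds hε)).and
    (hlim2.eventually_ge_atTop Λ)).exists
  refine ⟨2 ^ m, by linarith, fun v hv => ?_⟩
  have hmeas := hPm v hv
  have hset : ∀ t : ℝ, MeasurableSet {x : Rd d | t ≤ |v x|} := fun t =>
    measurableSet_le measurable_const (continuous_abs.measurable.comp hmeas)
  rw [← lintegral_indicator (hset _)]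
  calc _ ≤ ∫⁻ x, ∑' j : ℕ, ({x : Rd d | (2:ℝ) ^ (m + j) ≤ |v x|}).indicator
        (fun _ => ENNReal.ofReal (((2:ℝ) ^ (m + j + 1)) ^ p)) x := by
        apply lintegral_mono
        intro x
        by_cases hx : (2:ℝ) ^ m ≤ |v x|
        · have hone : (1:ℝ) ≤ |v x| / 2 ^ m := by rw [le_div_iff₀ (by positivity)]; linarith
          obtain ⟨j, hj1, hj2⟩ := exists_nat_pow_near hone (by norm_num : (1:ℝ) < 2)
          rw [le_div_iff₀ (by positivity)] at hj1
          rw [div_lt_iff₀ (by positivity)] at hj2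
          have hj1' : (2:ℝ) ^ (m + j) ≤ |v x| := by rw [pow_add]; linarith
          have hj2' : |v x| ≤ (2:ℝ) ^ (m + j + 1) := by
            rw [add_assoc, pow_add]; linarith
          refine le_trans ?_ (ENNReal.le_tsum j)
          rw [indicator_of_mem (by exact hx), indicator_of_mem (by exact hj1')]
          gcongr
        · rw [indicator_of_notMem (by exact hx)]
          exact zero_le
    _ = ∑' j : ℕ, ENNReal.ofReal (((2:ℝ) ^ (m + j + 1)) ^ p) *
          volume {x : Rd d | (2:ℝ) ^ (m + j) ≤ |v x|} := by
        rw [lintegral_tsum]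
        · congr 1; ext j
          rw [lintegral_indicator_const (hset _)]
        · intro j
          exact (measurable_const.indicator (hset _)).aemeasurable
    _ ≤ ∑' j : ℕ, ENNReal.ofReal (B * 2 ^ p * r ^ m * r ^ j) := by
        apply ENNReal.tsum_le_tsum
        intro j
        have hle : Λ ≤ (2:ℝ) ^ (m + j) := hm2.trans
          (pow_le_pow_right₀ (by norm_num) (by omega))
        refine (mul_le_mul_right (h v hv _ hle) _).trans ?_
        rw [← ENNReal.ofReal_mul (by positivity)]
        apply ENNReal.ofReal_le_ofReal
        apply le_of_eq
        have e1 : ((2:ℝ) ^ (m + j + 1)) ^ p = ((2:ℝ) ^ p) ^ (m + j) * 2 ^ p := by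
          rw [← Real.rpow_natCast, ← Real.rpow_mul (by norm_num), mul_comm,
            Real.rpow_mul (by norm_num), Real.rpow_natCast, pow_succ]
        have e2 : ((2:ℝ) ^ (m + j)) ^ (-q) = ((2:ℝ) ^ (-q)) ^ (m + j) := by
          rw [← Real.rpow_natCast, ← Real.rpow_mul (by norm_num), mul_comm,
            Real.rpow_mul (by norm_num), Real.rpow_natCast]
        have e3 : r = 2 ^ p * 2 ^ (-q) := by
          rw [hr, sub_eq_add_neg, Real.rpow_add (by norm_num)]
        rw [e1, e2, mul_assoc (B * 2 ^ p), ← pow_add, e3, mul_pow]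
        ring
    _ = ENNReal.ofReal (B * 2 ^ p * r ^ m * (1 - r)⁻¹) := by
        rw [← ENNReal.ofReal_tsum_of_nonneg]
        · rw [tsum_mul_left, tsum_geometric_of_lt_one hr0.le hr1]
        · intro j; positivity
        · exact (summable_geometric_of_lt_one hr0.le hr1).mul_left _
    _ ≤ _ := ENNReal.ofReal_le_ofReal hm1

lemma level_step {d : ℕ} (s : ℝ) (hs : 0 < s) (G : Rd d → Rd d → ℝ → ℝ) (gm C₁ : ℝ)
    (hgm : 0 < gm) (hC₁ : 0 < C₁)
    (hlow : ∀ x y t, 1 ≤ |t| → C₁ * |t| ^ gm ≤ G x y t)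
    (v : Rd d → ℝ) (hv : Measurable v) (hfrac : fracModular univ s G v ≤ 1)
    (t ρ : ℝ) (ht : 2 ≤ t) (hρ : 0 < ρ) (hρ1 : ρ ≤ 1)
    (hvol : 2 * volume {x : Rd d | t / 2 ≤ |v x|} ≤ volume (ball (0 : Rd d) ρ)) :
    ENNReal.ofReal (C₁ * (t / 2) ^ gm * ρ ^ (-(s * gm) - d)) * (volume (ball (0 : Rd d) ρ) / 2)
      * volume {x : Rd d | t ≤ |v x|} ≤ 1 := by
  set κ := ENNReal.ofReal (C₁ * (t / 2) ^ gm * ρ ^ (-(s * gm) - d)) with hκ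
  have hset : ∀ t : ℝ, MeasurableSet {x : Rd d | t ≤ |v x|} := fun t =>
    measurableSet_le measurable_const (continuous_abs.measurable.comp hv)
  refine le_trans ?_ hfrac
  unfold fracModular
  rw [Measure.restrict_univ, ← setLIntegral_const]
  refine (setLIntegral_mono' (hset t) ?_).trans (setLIntegral_le_lintegral _ _)
  intro x hx
  have hx' : t ≤ |v x| := hx
  have hball : volume (ball x ρ) = volume (ball (0 : Rd d) ρ) :=
    Measure.addHaar_ball_center volume x ρ
  have hfin : volume (ball (0 : Rd d) ρ) ≠ ⊤ := measure_ball_lt_top.ne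
  have hhalf : volume (ball (0 : Rd d) ρ) / 2 ≤
      volume (ball x ρ \ {x : Rd d | t / 2 ≤ |v x|}) := by
    refine le_trans ?_ le_measure_sdiff
    rw [hball]
    have : volume {x : Rd d | t / 2 ≤ |v x|} ≤ volume (ball (0 : Rd d) ρ) / 2 := by
      rw [ENNReal.le_div_iff_mul_le (by simp) (by simp), mul_comm]; exact hvol
    refine le_trans ?_ (tsub_le_tsub_left this _)
    rw [ENNReal.sub_half hfin]
  refine (mul_le_mul_right hhalf κ).trans ?_
  rw [← setLIntegral_const]
  refine (setLIntegral_mono' (measurableSet_ball.diff (hset _)) ?_).trans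
    (setLIntegral_le_lintegral _ _)
  rintro y ⟨hy1, hy2⟩
  have hy2' : |v y| < t / 2 := not_le.mp hy2
  have hdiff : t / 2 ≤ |v x - v y| := by
    have := abs_sub_abs_le_abs_sub (v x) (v y); linarith
  have hne : x ≠ y := by
    rintro rfl; linarith
  have hd0 : 0 < dist x y := dist_pos.mpr hne
  have hdρ : dist x y ≤ ρ := by rw [dist_comm]; exact (mem_ball.mp hy1).le
  apply ENNReal.ofReal_le_ofReal
  have hds : 0 < dist x y ^ s := by positivity
  have hds1 : dist x y ^ s ≤ 1 := Real.rpow_le_one hd0.le (hdρ.trans hρ1) hs.le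
  have habs : |(v x - v y) / dist x y ^ s| = |v x - v y| / dist x y ^ s := by
    rw [abs_div, abs_of_pos hds]
  have h1 : t / 2 / dist x y ^ s ≤ |(v x - v y) / dist x y ^ s| := by
    rw [habs]; gcongr
  have h2 : 1 ≤ |(v x - v y) / dist x y ^ s| := by
    refine le_trans ?_ h1
    rw [le_div_iff₀ hds]; linarith
  have h3 := hlow x y _ h2
  have ht2 : 0 < t / 2 := by linarith
  calc C₁ * (t / 2) ^ gm * ρ ^ (-(s * gm) - d)
      ≤ C₁ * (t / 2) ^ gm * dist x y ^ (-(s * gm) - d) := by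
        refine mul_le_mul_of_nonneg_left ?_ (by positivity)
        apply Real.rpow_le_rpow_of_nonpos hd0 hdρ
        have : 0 < s * gm := by positivity
        have : (0:ℝ) ≤ d := by positivity
        linarith
    _ = C₁ * (t / 2 / dist x y ^ s) ^ gm / dist x y ^ (d : ℝ) := by
        rw [Real.div_rpow ht2.le hds.le, ← Real.rpow_mul hd0.le, Real.rpow_sub hd0,
          Real.rpow_neg hd0.le]
        ring
    _ ≤ C₁ * |(v x - v y) / dist x y ^ s| ^ gm / dist x y ^ (d : ℝ) := by
        gcongr
    _ ≤ _ := by gcongr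

lemma decay_step {d : ℕ} (hd : 2 ≤ d) (s : ℝ) (hs : 0 < s) (G : Rd d → Rd d → ℝ → ℝ) (gm C₁ : ℝ)
    (hgm : 0 < gm) (hC₁ : 0 < C₁)
    (hlow : ∀ x y t, 1 ≤ |t| → C₁ * |t| ^ gm ≤ G x y t)
    (P : (Rd d → ℝ) → Prop) (hPm : ∀ v, P v → Measurable v)
    (hPf : ∀ v, P v → fracModular univ s G v ≤ 1)
    (q : ℝ) (hq : 0 < q) (hD : Decay P q) : Decay P (gm + s * gm / d * q) := by
  obtain ⟨B, hB, Λ, hΛ, h⟩ := hD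
  have hd0 : (0:ℝ) < d := by positivity
  set c : ℝ := (volume (ball (0 : Rd d) 1)).toReal with hc
  have hcfin : volume (ball (0 : Rd d) 1) ≠ ⊤ := measure_ball_lt_top.ne
  have hc0 : 0 < c := ENNReal.toReal_pos (measure_ball_pos _ _ one_pos).ne' hcfin
  have hballvol : ∀ ρ : ℝ, 0 < ρ → volume (ball (0 : Rd d) ρ) = ENNReal.ofReal (ρ ^ d * c) := by
    intro ρ hρ
    rw [Measure.addHaar_ball_of_pos volume _ hρ, ENNReal.ofReal_mul (by positivity), hc,
      ENNReal.ofReal_toReal hcfin, finrank_euclideanSpace, Fintype.card_fin]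
  set D : ℝ := 2 * B / c * (1/2) ^ (-q) with hDdef
  have hD0 : 0 < D := by positivity
  have hlim : Tendsto (fun t : ℝ => D * t ^ (-q)) atTop (𝓝 0) := by
    simpa using (tendsto_rpow_neg_atTop hq).const_mul D
  obtain ⟨T, hT⟩ := (hlim.eventually (eventually_le_nhds one_pos)).exists_forall_of_atTop
  set B' : ℝ := (C₁ * (1/2) ^ gm * (c / 2))⁻¹ * D ^ (s * gm / d) with hB'
  refine ⟨B', by positivity, max (max T (2 * Λ)) 2, by
    exact le_trans (by norm_num) (le_max_right _ _), ?_⟩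
  intro v hv t ht
  have htT : T ≤ t := le_trans (le_trans (le_max_left _ _) (le_max_left _ _)) ht
  have htΛ : 2 * Λ ≤ t := le_trans (le_trans (le_max_right _ _) (le_max_left _ _)) ht
  have ht2 : 2 ≤ t := le_trans (le_max_right _ _) ht
  have ht0 : 0 < t := by linarith
  set E : ℝ := D * t ^ (-q) with hE
  have hE0 : 0 < E := by positivity
  have hE1 : E ≤ 1 := hT t htT
  set ρ : ℝ := E ^ ((d:ℝ)⁻¹) with hρdef
  have hρ : 0 < ρ := by positivity
  have hρ1 : ρ ≤ 1 := Real.rpow_le_one hE0.le hE1 (by positivity)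
  have hρd : ρ ^ d = E := by
    rw [hρdef]; exact Real.rpow_inv_natCast_pow hE0.le (by omega)
  have hhalf : t / 2 = t * (1/2) := by ring
  have hvol : 2 * volume {x : Rd d | t / 2 ≤ |v x|} ≤ volume (ball (0 : Rd d) ρ) := by
    rw [hballvol ρ hρ, hρd]
    refine (mul_le_mul_right (h v hv (t / 2) (by linarith)) _).trans ?_
    rw [show (2:ℝ≥0∞) = ENNReal.ofReal 2 by simp, ← ENNReal.ofReal_mul (by norm_num)]
    apply ENNReal.ofReal_le_ofReal
    apply le_of_eq
    rw [hE, hDdef, hhalf, Real.mul_rpow ht0.le (by norm_num)]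
    field_simp
  have key := level_step s hs G gm C₁ hgm hC₁ hlow v (hPm v hv) (hPf v hv) t ρ ht2 hρ hρ1 hvol
  have h2d : ENNReal.ofReal (ρ ^ d * c) / 2 = ENNReal.ofReal (ρ ^ d * c / 2) := by
    rw [ENNReal.ofReal_div_of_pos (by norm_num)]; simp
  rw [hballvol ρ hρ, h2d, ← ENNReal.ofReal_mul (by positivity)] at key
  set X := C₁ * (t / 2) ^ gm * ρ ^ (-(s * gm) - d) * (ρ ^ d * c / 2) with hX
  have hX0 : 0 < X := by positivity
  have hXB : B' * t ^ (-(gm + s * gm / d * q)) = X⁻¹ := by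
    have e1 : ρ ^ (-(s * gm) - d) = E ^ (-(s * gm / d)) * E⁻¹ := by
      rw [hρdef, ← Real.rpow_mul hE0.le, ← Real.rpow_neg_one E, ← Real.rpow_add hE0]
      congr 1; field_simp; ring
    rw [hX, e1, hρd, hhalf, Real.mul_rpow ht0.le (by norm_num), hE,
      Real.mul_rpow hD0.le (by positivity), ← Real.rpow_mul ht0.le, hB', Real.rpow_neg hD0.le,
      neg_add, Real.rpow_add ht0, Real.rpow_neg ht0.le gm,
      show -q * -(s * gm / d) = s * gm / d * q by ring, Real.rpow_neg ht0.le (s * gm / d * q)]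
    field_simp
  rw [hXB, ENNReal.ofReal_inv_of_pos hX0]
  rw [ENNReal.le_inv_iff_mul_le, mul_comm]
  exact key

/-- the normalized class -/
def Cls {d : ℕ} (s : ℝ) (G : Rd d → Rd d → ℝ → ℝ) (V : Rd d → ℝ) (v : Rd d → ℝ) : Prop :=
  Measurable v ∧ wModular G V v ≤ 1 ∧ fracModular univ s G v ≤ 1

lemma decay_init {d : ℕ} (s : ℝ) (G : Rd d → Rd d → ℝ → ℝ) (V : Rd d → ℝ) (gm C₁ V₀ : ℝ)
    (hC₁ : 0 < C₁) (hV₀ : 0 < V₀) (hV : ∀ x, V₀ ≤ V x) (hgm : 0 < gm)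
    (hlow : ∀ x y t, 1 ≤ |t| → C₁ * |t| ^ gm ≤ G x y t) : Decay (Cls s G V) gm := by
  refine ⟨(V₀ * C₁)⁻¹, by positivity, 1, le_rfl, ?_⟩
  rintro v ⟨hv, hw, -⟩ t ht
  have ht0 : 0 < t := by linarith
  have hset : MeasurableSet {x : Rd d | t ≤ |v x|} :=
    measurableSet_le measurable_const (continuous_abs.measurable.comp hv)
  rw [Real.rpow_neg ht0.le, ← mul_inv, ENNReal.ofReal_inv_of_pos (by positivity),
    ENNReal.le_inv_iff_mul_le, mul_comm, ← setLIntegral_const]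
  refine le_trans ?_ hw
  refine (setLIntegral_mono' hset ?_).trans (setLIntegral_le_lintegral _ _)
  intro x hx
  have hx' : t ≤ |v x| := hx
  apply ENNReal.ofReal_le_ofReal
  have h1 := hlow x x |v x| (by rw [abs_abs]; linarith)
  rw [abs_abs] at h1
  have h2 : C₁ * t ^ gm ≤ C₁ * |v x| ^ gm := by gcongr
  have h3 : 0 ≤ C₁ * t ^ gm := by positivity
  have h4 := hV x
  calc V₀ * C₁ * t ^ gm = V₀ * (C₁ * t ^ gm) := by ring
    _ ≤ V x * G x x |v x| := mul_le_mul h4 (h2.trans h1) h3 (by linarith)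

lemma decay_final {d : ℕ} (hd : 2 ≤ d) (s : ℝ) (hs : 0 < s) (G : Rd d → Rd d → ℝ → ℝ)
    (V : Rd d → ℝ) (gm gp C₁ V₀ : ℝ)
    (hC₁ : 0 < C₁) (hV₀ : 0 < V₀) (hV : ∀ x, V₀ ≤ V x) (hgm : 0 < gm) (hsg : s * gm < d)
    (hgp : gp < (d : ℝ) * gm / ((d : ℝ) - s * gm))
    (hlow : ∀ x y t, 1 ≤ |t| → C₁ * |t| ^ gm ≤ G x y t) :
    ∃ q, gp < q ∧ Decay (Cls s G V) q := by
  have hd0 : (0:ℝ) < d := by positivity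
  set θ : ℝ := s * gm / d with hθ
  have hθ0 : 0 < θ := by positivity
  have hθ1 : θ < 1 := by rw [hθ, div_lt_one hd0]; exact hsg
  set Q : ℝ := (d : ℝ) * gm / ((d : ℝ) - s * gm) with hQ
  have hden : (0:ℝ) < d - s * gm := by linarith
  have hQ0 : 0 < Q := by positivity
  have hQe : gm = Q * (1 - θ) := by
    rw [hQ, hθ, show 1 - s * gm / (d:ℝ) = (d - s * gm) / d by field_simp]
    generalize (d:ℝ) - s * gm = w at hden
    field_simp
  have hall : ∀ k : ℕ, Decay (Cls s G V) (Q * (1 - θ ^ (k + 1))) := by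
    intro k
    induction k with
    | zero =>
      rw [zero_add, pow_one, ← hQe]
      exact decay_init s G V gm C₁ V₀ hC₁ hV₀ hV hgm hlow
    | succ k ih =>
      have hpos : 0 < Q * (1 - θ ^ (k + 1)) :=
        mul_pos hQ0 (sub_pos.mpr (pow_lt_one₀ hθ0.le hθ1 (by omega)))
      have := decay_step hd s hs G gm C₁ hgm hC₁ hlow (Cls s G V) (fun v h => h.1)
        (fun v h => h.2.2) _ hpos ih
      convert this using 1
      rw [← hθ]
      calc Q * (1 - θ ^ (k + 1 + 1)) = Q * (1 - θ) + θ * (Q * (1 - θ ^ (k + 1))) := by ring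
        _ = _ := by rw [← hQe]
  have hlim : Tendsto (fun k : ℕ => Q * (1 - θ ^ (k + 1))) atTop (𝓝 Q) := by
    have := (((tendsto_pow_atTop_nhds_zero_of_lt_one hθ0.le hθ1).comp
      (tendsto_add_atTop_nat 1)).const_sub 1).const_mul Q
    simpa using this
  obtain ⟨k, hk⟩ := (hlim.eventually (lt_mem_nhds hgp)).exists
  exact ⟨_, hk, hall k⟩

lemma small_tail {d : ℕ} (V : Rd d → ℝ) (hV : Measurable V) (L : ℝ)
    (hfin : volume {x : Rd d | V x < L} < ⊤) (ε : ℝ≥0∞) (hε : 0 < ε) :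
    ∃ r : ℝ, 0 < r ∧ volume ({x : Rd d | r < ‖x‖} ∩ {x | V x < L}) ≤ ε := by
  have hVm : MeasurableSet {x : Rd d | V x < L} := measurableSet_lt hV measurable_const
  have hm : ∀ n : ℕ, MeasurableSet ({x : Rd d | (n:ℝ) < ‖x‖} ∩ {x | V x < L}) := fun n =>
    (measurableSet_lt measurable_const measurable_norm).inter hVm
  have h := tendsto_measure_iInter_atTop (μ := volume)
    (s := fun n : ℕ => {x : Rd d | (n:ℝ) < ‖x‖} ∩ {x | V x < L})
    (fun n => (hm n).nullMeasurableSet)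
    (by
      intro a b hab x hx
      have h1 : (b:ℝ) < ‖x‖ := hx.1
      have h2 : (a:ℝ) ≤ b := by exact_mod_cast hab
      exact ⟨lt_of_le_of_lt h2 h1, hx.2⟩)
    ⟨0, ((measure_mono inter_subset_right).trans_lt hfin).ne⟩
  have hemp : ⋂ n : ℕ, ({x : Rd d | (n:ℝ) < ‖x‖} ∩ {x | V x < L}) = ∅ := by
    ext x
    simp only [mem_iInter, mem_empty_iff_false, iff_false, not_forall]
    obtain ⟨n, hn⟩ := exists_nat_ge ‖x‖
    exact ⟨n, fun h => absurd h.1 (not_lt.mpr hn)⟩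
  rw [hemp, measure_empty] at h
  obtain ⟨n, hn, hn1⟩ := ((h.eventually (eventually_le_nhds hε)).and
    (eventually_ge_atTop 1)).exists
  refine ⟨n, by exact_mod_cast hn1, hn⟩

lemma class_tail {d : ℕ} (s : ℝ) (G : Rd d → Rd d → ℝ → ℝ)
    (V : Rd d → ℝ) (gp C₂ V₀ : ℝ) (hC₂ : 0 < C₂) (hV : VHyps V V₀) (hgp : 0 < gp)
    (q : ℝ) (hq : gp < q) (hD : Decay (Cls s G V) q)
    (hnn : ∀ x y t, 0 ≤ G x y t)
    (hup : ∀ x y t K, 1 ≤ K → |t| ≤ K → G x y t ≤ C₂ * K ^ gp)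
    (ε : ℝ) (hε : 0 < ε) :
    ∃ r : ℝ, 0 < r ∧ ∀ v, Cls s G V v →
      ∫⁻ x in {x : Rd d | r < ‖x‖}, ENNReal.ofReal (G x x |v x|) ≤ ENNReal.ofReal (3 * ε) := by
  obtain ⟨hVm, hV₀, hVl, hVf⟩ := hV
  obtain ⟨K, hK, hKt⟩ := decay_tail (Cls s G V) (fun v h => h.1) q gp hgp hq hD (ε / C₂)
    (by positivity)
  have hLpos : 0 < ε⁻¹ := by positivity
  have hCK : 0 < C₂ * K ^ gp := by positivity
  obtain ⟨r, hr, hrv⟩ := small_tail V hVm ε⁻¹ (hVf _ hLpos)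
    (ENNReal.ofReal (ε / (C₂ * K ^ gp))) (by rw [ENNReal.ofReal_pos]; positivity)
  refine ⟨r, hr, fun v hv => ?_⟩
  have hsetK : MeasurableSet {x : Rd d | K ≤ |v x|} :=
    measurableSet_le measurable_const (continuous_abs.measurable.comp hv.1)
  have hsetV : MeasurableSet {x : Rd d | V x < ε⁻¹} := measurableSet_lt hVm measurable_const
  rw [← lintegral_inter_add_diff _ _ hsetV]
  have p1 : ∫⁻ x in {x : Rd d | r < ‖x‖} ∩ {x | V x < ε⁻¹}, ENNReal.ofReal (G x x |v x|)
      ≤ ENNReal.ofReal ε + ENNReal.ofReal ε := by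
    calc _ ≤ ∫⁻ x in {x : Rd d | r < ‖x‖} ∩ {x | V x < ε⁻¹},
          (ENNReal.ofReal (C₂ * K ^ gp) + ({x : Rd d | K ≤ |v x|}).indicator
            (fun x => ENNReal.ofReal C₂ * ENNReal.ofReal (|v x| ^ gp)) x) := by
          apply lintegral_mono
          intro x
          by_cases hx : K ≤ |v x|
          · simp only
            rw [indicator_of_mem (by exact hx), ← ENNReal.ofReal_mul hC₂.le]
            refine le_trans ?_ le_add_self
            exact ENNReal.ofReal_le_ofReal (hup _ _ _ _ (hK.trans hx) (abs_abs _).le)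
          · refine le_trans ?_ le_self_add
            exact ENNReal.ofReal_le_ofReal
              (hup _ _ _ _ hK ((abs_abs _).le.trans (not_le.mp hx).le))
      _ = ENNReal.ofReal (C₂ * K ^ gp) * volume ({x : Rd d | r < ‖x‖} ∩ {x | V x < ε⁻¹})
          + ∫⁻ x in {x : Rd d | r < ‖x‖} ∩ {x | V x < ε⁻¹}, ({x : Rd d | K ≤ |v x|}).indicator
            (fun x => ENNReal.ofReal C₂ * ENNReal.ofReal (|v x| ^ gp)) x := by
          rw [lintegral_add_left measurable_const, setLIntegral_const]
      _ ≤ ENNReal.ofReal (C₂ * K ^ gp) * ENNReal.ofReal (ε / (C₂ * K ^ gp))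
          + ENNReal.ofReal C₂ * ENNReal.ofReal (ε / C₂) := by
          gcongr
          refine (setLIntegral_le_lintegral _ _).trans ?_
          rw [lintegral_indicator hsetK, lintegral_const_mul' _ _ ENNReal.ofReal_ne_top]
          gcongr
          exact hKt v hv
      _ = _ := by
          rw [← ENNReal.ofReal_mul hCK.le, ← ENNReal.ofReal_mul hC₂.le,
            mul_div_cancel₀ _ hCK.ne', mul_div_cancel₀ _ hC₂.ne']
  have p2 : ∫⁻ x in {x : Rd d | r < ‖x‖} \ {x | V x < ε⁻¹}, ENNReal.ofReal (G x x |v x|)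
      ≤ ENNReal.ofReal ε := by
    have hms : MeasurableSet ({x : Rd d | r < ‖x‖} \ {x | V x < ε⁻¹}) :=
      (measurableSet_lt measurable_const measurable_norm).diff hsetV
    calc _ ≤ ∫⁻ x in {x : Rd d | r < ‖x‖} \ {x | V x < ε⁻¹},
          ENNReal.ofReal ε * ENNReal.ofReal (V x * G x x |v x|) := by
          apply setLIntegral_mono' hms
          rintro x ⟨-, hx⟩
          have hx' : ε⁻¹ ≤ V x := not_lt.mp hx
          rw [← ENNReal.ofReal_mul hε.le]
          apply ENNReal.ofReal_le_ofReal
          have h1 : 1 ≤ ε * V x := by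
            have := mul_le_mul_of_nonneg_left hx' hε.le
            rwa [mul_inv_cancel₀ hε.ne'] at this
          nlinarith [hnn x x |v x|]
      _ ≤ ∫⁻ x, ENNReal.ofReal ε * ENNReal.ofReal (V x * G x x |v x|) :=
          setLIntegral_le_lintegral _ _
      _ = ENNReal.ofReal ε * wModular G V v := lintegral_const_mul' _ _ ENNReal.ofReal_ne_top
      _ ≤ ENNReal.ofReal ε * 1 := by gcongr; exact hv.2.1
      _ = _ := mul_one _
  calc _ ≤ ENNReal.ofReal ε + ENNReal.ofReal ε + ENNReal.ofReal ε := add_le_add p1 p2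
    _ = _ := by
      rw [← ENNReal.ofReal_add hε.le hε.le, ← ENNReal.ofReal_add (by positivity) hε.le]
      congr 1; ring

/-- Claim in the proof of Theorem 1.2: uniform tail smallness for
bounded sequences in the weighted space `E`. -/
theorem uniform_tail_smallness
    (d : ℕ) (s : ℝ) (a g G : Rd d → Rd d → ℝ → ℝ) (gm gp : ℝ)
    (Ginv : Rd d → ℝ → ℝ) (V : Rd d → ℝ) (V₀ : ℝ)
    (hG : GHyps d univ s a g G gm gp)
    (hg5 : G5Hyps d univ s G Ginv)
    (hBf : Bf univ G)
    (hV : VHyps V V₀)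
    (u : ℕ → Rd d → ℝ)
    (hmem : ∀ n, memE s G V (u n))
    (hbd : ∃ M : ℝ, ∀ n, normE s G V (u n) ≤ M) :
    ∀ ε : ℝ, 0 < ε → ∃ r : ℝ, 0 < r ∧ ∃ N : ℕ, ∀ n, N ≤ n →
      (∫⁻ x in {x : Rd d | r < ‖x‖}, ENNReal.ofReal (G x x |u n x|))
        < ENNReal.ofReal ε := by
  obtain ⟨hd, hs, -, hsg, ha, hga, hg0, -, hGdef, -, -, hac, -, hgm, hgmp, hgp, hrat⟩ := hG
  obtain ⟨C₁, C₂, hC₁, hB⟩ := hBf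
  have hC₂ : 0 < C₂ := lt_of_lt_of_le hC₁
    ((hB 0 (mem_univ _) 0 (mem_univ _)).1.trans (hB 0 (mem_univ _) 0 (mem_univ _)).2)
  obtain ⟨M, hM⟩ := hbd
  have hgm0 : 0 < gm := by linarith
  have hgp0 : 0 < gp := by linarith
  have heven : ∀ x y t, G x y |t| = G x y t := by
    intro x y t
    rw [hGdef x (mem_univ _) y (mem_univ _) t, hGdef x (mem_univ _) y (mem_univ _) |t|, abs_abs]
  have hzero : ∀ x y, G x y 0 = 0 := by
    intro x y
    rw [hGdef x (mem_univ _) y (mem_univ _) 0]; simp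
  have hgnn : ∀ x y t, 0 < t → 0 ≤ g x y t := by
    intro x y t ht
    rw [hga x (mem_univ _) y (mem_univ _) t ht]
    exact (mul_pos (ha x (mem_univ _) y (mem_univ _) t ht) ht).le
  have hnn : ∀ x y t, 0 ≤ G x y t := by
    intro x y t
    rw [hGdef x (mem_univ _) y (mem_univ _) t]
    exact setIntegral_nonneg measurableSet_Ioc (fun τ hτ => hgnn x y τ hτ.1)
  have hpos : ∀ x y t, 0 < t → 0 < G x y t := by
    intro x y t ht
    refine lt_of_le_of_ne (hnn x y t) ?_
    intro h0
    have := (hrat x (mem_univ _) y (mem_univ _) t ht).1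
    rw [← h0, div_zero] at this
    linarith
  have hscale' : ∀ x y t k, 0 < t → 1 ≤ k →
      k ^ gm * G x y t ≤ G x y (k * t) ∧ G x y (k * t) ≤ k ^ gp * G x y t := by
    intro x y
    apply aux_oneVar (g x y) (G x y) gm gp
    · have hc : ContinuousOn (fun t => a x y t * t) (Ioi 0) :=
        (hac x (mem_univ _) y (mem_univ _)).mul continuousOn_id
      exact hc.congr (fun t ht => hga x (mem_univ _) y (mem_univ _) t ht)
    · exact hGdef x (mem_univ _) y (mem_univ _)
    · exact hpos x y
    · intro t ht
      have := (hrat x (mem_univ _) y (mem_univ _) t ht).1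
      rw [le_div_iff₀ (hpos x y t ht)] at this
      rw [hga x (mem_univ _) y (mem_univ _) t ht]
      nlinarith
    · intro t ht
      have := (hrat x (mem_univ _) y (mem_univ _) t ht).2
      rw [div_le_iff₀ (hpos x y t ht)] at this
      rw [hga x (mem_univ _) y (mem_univ _) t ht]
      nlinarith
  have hscale : ∀ x y t k, 1 ≤ k →
      k ^ gm * G x y t ≤ G x y (k * t) ∧ G x y (k * t) ≤ k ^ gp * G x y t := by
    intro x y t k hk
    have hk0 : 0 < k := by linarith
    rcases eq_or_ne t 0 with rfl | ht
    · simp [hzero]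
    · have := hscale' x y |t| k (abs_pos.mpr ht) hk
      rwa [heven, show k * |t| = |k * t| by rw [abs_mul, abs_of_pos hk0], heven] at this
  have hmono : ∀ x y t k, 1 ≤ k → G x y t ≤ G x y (k * t) := by
    intro x y t k hk
    refine le_trans ?_ (hscale x y t k hk).1
    exact le_mul_of_one_le_left (hnn x y t) (Real.one_le_rpow hk hgm0.le)
  have hlow : ∀ x y t, 1 ≤ |t| → C₁ * |t| ^ gm ≤ G x y t := by
    intro x y t ht
    have h1 := (hscale x y 1 |t| ht).1
    rw [mul_one, heven] at h1
    refine le_trans ?_ h1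
    rw [mul_comm]
    gcongr
    exact (hB x (mem_univ _) y (mem_univ _)).1
  have hup : ∀ x y t K, 1 ≤ K → |t| ≤ K → G x y t ≤ C₂ * K ^ gp := by
    intro x y t K hK htK
    have h1 := (hscale x y 1 K hK).2
    have h2 : K ^ gp * G x y 1 ≤ C₂ * K ^ gp := by
      rw [mul_comm]
      gcongr
      exact (hB x (mem_univ _) y (mem_univ _)).2
    refine le_trans ?_ (h1.trans h2)
    rw [mul_one]
    rcases eq_or_ne t 0 with rfl | ht
    · rw [hzero]; exact hnn _ _ _
    · have ht0 := abs_pos.mpr ht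
      have h3 := hmono x y |t| (K / |t|) (by rwa [le_div_iff₀ ht0, one_mul])
      rwa [heven, div_mul_cancel₀ _ ht0.ne'] at h3
  obtain ⟨q, hq, hD⟩ := decay_final hd s hs G V gm gp C₁ V₀ hC₁ hV.2.1 hV.2.2.1 hgm0 hsg hgp hlow
  set l : ℝ := max M 0 + 1 with hl
  have hl1 : 1 ≤ l := by rw [hl]; linarith [le_max_right M 0]
  have hl0 : 0 < l := by linarith
  have hcls : ∀ n, Cls s G V (fun x => u n x / l) := by
    intro n
    obtain ⟨⟨hum, -, hfr⟩, hw⟩ := hmem n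
    have hgag0 : 0 ≤ gagliardo univ s G (u n) := Real.sInf_nonneg (fun b hb => hb.1.le)
    have hw0 : 0 ≤ wNorm G V (u n) := Real.sInf_nonneg (fun b hb => hb.1.le)
    have hsum := hM n
    unfold normE at hsum
    have hMl : M < l := by rw [hl]; linarith [le_max_left M 0]
    refine ⟨hum.div_const _, ?_, ?_⟩
    · have hne : {b : ℝ | 0 < b ∧ wModular G V (fun x => u n x / b) ≤ 1}.Nonempty := by
        set A := wModular G V (u n) with hA
        set b : ℝ := A.toReal + 1 with hb
        have hb1 : 1 ≤ b := by rw [hb]; linarith [ENNReal.toReal_nonneg (a := A)]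
        have hb0 : 0 < b := by linarith
        refine ⟨b, hb0, ?_⟩
        have hAb : A ≤ ENNReal.ofReal b := by
          rw [← ENNReal.ofReal_toReal hw.ne]
          exact ENNReal.ofReal_le_ofReal (by linarith)
        have h1 : wModular G V (fun x => u n x / b) ≤ ENNReal.ofReal b⁻¹ * A := by
          rw [hA]
          unfold wModular
          rw [← lintegral_const_mul' _ _ ENNReal.ofReal_ne_top]
          apply lintegral_mono
          intro x
          simp only
          rw [← ENNReal.ofReal_mul (by positivity)]
          apply ENNReal.ofReal_le_ofReal
          have h2 := (hscale x x (u n x / b) b hb1).1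
          rw [mul_div_cancel₀ _ hb0.ne'] at h2
          have h3 : b ≤ b ^ gm := by
            conv_lhs => rw [← Real.rpow_one b]
            exact Real.rpow_le_rpow_of_exponent_le hb1 hgm.le
          have h4 : b * G x x (u n x / b) ≤ G x x (u n x) :=
            (mul_le_mul_of_nonneg_right h3 (hnn _ _ _)).trans h2
          have hVx : 0 ≤ V x := hV.2.1.le.trans (hV.2.2.1 x)
          rw [heven, heven]
          calc V x * G x x (u n x / b) = b⁻¹ * (V x * (b * G x x (u n x / b))) := by
                field_simp
            _ ≤ _ := by gcongr
        refine h1.trans ((mul_le_mul_right hAb _).trans ?_)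
        rw [← ENNReal.ofReal_mul (by positivity), inv_mul_cancel₀ hb0.ne']
        simp
      have hlt : sInf {b : ℝ | 0 < b ∧ wModular G V (fun x => u n x / b) ≤ 1} < l := by
        unfold wNorm at hsum; linarith
      obtain ⟨b, ⟨hb0, hb⟩, hbl⟩ := exists_lt_of_csInf_lt hne hlt
      refine le_trans ?_ hb
      apply lintegral_mono
      intro x
      apply ENNReal.ofReal_le_ofReal
      have hVx : 0 ≤ V x := hV.2.1.le.trans (hV.2.2.1 x)
      refine mul_le_mul_of_nonneg_left ?_ hVx
      rw [heven, heven]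
      have := hmono x x (u n x / l) (l / b) (by rw [le_div_iff₀ hb0]; linarith)
      rwa [show l / b * (u n x / l) = u n x / b by field_simp] at this
    · have hlt : sInf {b : ℝ | 0 < b ∧ fracModular univ s G (fun x => u n x / b) ≤ 1} < l := by
        unfold gagliardo at hsum; linarith
      obtain ⟨b, ⟨hb0, hb⟩, hbl⟩ := exists_lt_of_csInf_lt hfr hlt
      refine le_trans ?_ hb
      apply lintegral_mono
      intro x
      apply lintegral_mono
      intro y
      apply ENNReal.ofReal_le_ofReal
      refine div_le_div_of_nonneg_right ?_ (by positivity)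
      have := hmono x y ((u n x / l - u n y / l) / dist x y ^ s) (l / b)
        (by rw [le_div_iff₀ hb0]; linarith)
      rwa [show l / b * ((u n x / l - u n y / l) / dist x y ^ s)
        = (u n x / b - u n y / b) / dist x y ^ s by field_simp] at this
  intro ε hε
  have hlg : 0 < l ^ gp := by positivity
  obtain ⟨r, hr, hrt⟩ := class_tail s G V gp C₂ V₀ hC₂ hV hgp0 q hq hD hnn hup
    (ε / l ^ gp / 4) (by positivity)
  refine ⟨r, hr, 0, fun n _ => ?_⟩
  have h1 := hrt _ (hcls n)
  calc _ ≤ ∫⁻ x in {x : Rd d | r < ‖x‖}, ENNReal.ofReal (l ^ gp) *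
        ENNReal.ofReal (G x x |u n x / l|) := by
        apply lintegral_mono
        intro x
        simp only
        rw [← ENNReal.ofReal_mul hlg.le]
        apply ENNReal.ofReal_le_ofReal
        have := (hscale x x (u n x / l) l hl1).2
        rw [mul_div_cancel₀ _ hl0.ne'] at this
        rwa [heven, heven]
    _ = ENNReal.ofReal (l ^ gp) * ∫⁻ x in {x : Rd d | r < ‖x‖},
        ENNReal.ofReal (G x x |u n x / l|) := lintegral_const_mul' _ _ ENNReal.ofReal_ne_top
    _ ≤ ENNReal.ofReal (l ^ gp) * ENNReal.ofReal (3 * (ε / l ^ gp / 4)) := by gcongr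
    _ = ENNReal.ofReal (3 / 4 * ε) := by
        rw [← ENNReal.ofReal_mul hlg.le]
        congr 1
        field_simp
    _ < ENNReal.ofReal ε := by
        rw [ENNReal.ofReal_lt_ofReal_iff hε]; linarith
end
end

section
/- (Coercivity of the energy functional.) Under hypotheses (g1)–(g5), (B_f), (V1), (V2), the exponent conditions on p and δ, and hypothesis (B) on b, the functional I(u) := J_{s,G}(u) + ∫_{ℝ^d} V(x)Ĝ(x,|u(x)|)dx − ∫_{ℝ^d} (1/p(x)) b(x)|u(x)|^{p(x)}dx is coercive on E: I(u_n) → +∞ for every sequence (u_n) ⊂ E with ‖u_n‖_E → +∞. -/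
open MeasureTheory Filter Set Metric Topology
open scoped ENNReal NNReal

noncomputable section

lemma aux_deriv (a g G : ℝ → ℝ) 
    (hg : ∀ t : ℝ, 0 < t → g t = a t * t)
    (hGi : ∀ t : ℝ, G t = ∫ τ in Ioc (0:ℝ) |t|, g τ)
    (h0 : Tendsto (fun t => a t * t) (𝓝[>] (0:ℝ)) (𝓝 0))
    (hc : ContinuousOn (fun t => a t) (Ioi (0:ℝ))) :
    ∀ t : ℝ, 0 < t → HasDerivAt G (a t * t) t := by
  set h : ℝ → ℝ := fun τ => if τ ≤ 0 then 0 else a τ * τ with hh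
  have hcont : Continuous h := by
    rw [continuous_iff_continuousAt]
    intro x
    rcases lt_trichotomy x 0 with hx | hx | hx
    · have : h =ᶠ[𝓝 x] fun _ => 0 := by
        filter_upwards [gt_mem_nhds hx] with y hy
        simp [hh, hy.le]
      exact (continuousAt_const).congr this.symm
    · subst hx
      rw [continuousAt_iff_continuous_left'_right']
      constructor
      · have : Tendsto (fun _ : ℝ => (0:ℝ)) (𝓝[<] (0:ℝ)) (𝓝 (h 0)) := by
          simp [hh]
        refine Tendsto.congr' ?_ this
        filter_upwards [self_mem_nhdsWithin] with y hy
        simp [hh, (mem_Iio.1 hy).le]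
      · have h00 : h 0 = 0 := by simp [hh]
        unfold ContinuousWithinAt
        rw [h00]
        refine Tendsto.congr' ?_ h0
        filter_upwards [self_mem_nhdsWithin] with y hy
        simp [hh, not_le.2 (mem_Ioi.1 hy)]
    · have : h =ᶠ[𝓝 x] fun τ => a τ * τ := by
        filter_upwards [lt_mem_nhds hx] with y hy
        simp [hh, not_le.2 hy]
      refine ContinuousAt.congr ?_ this.symm
      exact (hc.continuousAt (Ioi_mem_nhds hx)).mul continuousAt_id
  intro t ht
  have hd : HasDerivAt (fun u => ∫ τ in (0:ℝ)..u, h τ) (h t) t :=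
    (hcont.integral_hasStrictDerivAt 0 t).hasDerivAt
  have ht' : h t = a t * t := by simp [hh, not_le.2 ht]
  rw [ht'] at hd
  refine hd.congr_of_eventuallyEq ?_
  filter_upwards [lt_mem_nhds ht] with u hu
  rw [hGi, intervalIntegral.integral_of_le hu.le, abs_of_pos hu]
  refine setIntegral_congr_fun measurableSet_Ioc ?_
  intro τ hτ
  simp [hh, not_le.2 hτ.1, hg τ hτ.1]

lemma aux_scale (a G : ℝ → ℝ) (gm gp : ℝ)
    (hd : ∀ t : ℝ, 0 < t → HasDerivAt G (a t * t) t)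
    (hpos : ∀ t : ℝ, 0 < t → 0 < G t)
    (hb : ∀ t : ℝ, 0 < t → gm ≤ a t * t ^ 2 / G t ∧ a t * t ^ 2 / G t ≤ gp) 
    (t l : ℝ) (ht : 0 < t) (hl : 1 ≤ l) :
    l ^ gm * G t ≤ G (l * t) ∧ G (l * t) ≤ l ^ gp * G t := by
  have hl0 : 0 < l := by linarith
  have key : ∀ r u : ℝ, 0 < u → HasDerivAt (fun u => G u * u ^ (-r)) 
      (u ^ (-r-1) * (a u * u ^ 2 - r * G u)) u := by
    intro r u hu
    have := (hd u hu).mul (Real.hasDerivAt_rpow_const (p := -r) (Or.inl hu.ne'))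
    refine this.congr_deriv ?_
    have : u ^ (-r) = u ^ (-r-1) * u := by
      rw [← Real.rpow_add_one hu.ne']; ring_nf
    rw [this]; ring
  have hle : t ≤ l * t := by nlinarith
  have hlt : 0 < l * t := by positivity
  have e : ∀ r : ℝ, (l*t) ^ (-r) = l ^ (-r) * t ^ (-r) := fun r => 
    Real.mul_rpow hl0.le ht.le
  have conv : Convex ℝ (Ioi (0:ℝ)) := convex_Ioi 0
  constructor
  · have mono : MonotoneOn (fun u => G u * u ^ (-gm)) (Ioi 0) := by
      apply monotoneOn_of_deriv_nonneg conv
      · intro u hu; exact (key gm u hu).continuousAt.continuousWithinAt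
      · intro u hu; rw [interior_Ioi] at hu
        exact (key gm u hu).differentiableAt.differentiableWithinAt
      · intro u hu; rw [interior_Ioi] at hu
        rw [(key gm u hu).deriv]
        have h1 := (hb u hu).1
        rw [le_div_iff₀ (hpos u hu)] at h1
        have : 0 < u ^ (-gm-1) := Real.rpow_pos_of_pos hu _
        apply mul_nonneg this.le; linarith
    have := mono (mem_Ioi.2 ht) (mem_Ioi.2 hlt) hle
    simp only [e] at this
    have hp : 0 < t ^ (-gm) := Real.rpow_pos_of_pos ht _
    have : G t ≤ G (l*t) * l ^ (-gm) := by
      refine le_of_mul_le_mul_right ?_ hp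
      linarith
    rw [Real.rpow_neg hl0.le, ← div_eq_mul_inv, le_div_iff₀ (Real.rpow_pos_of_pos hl0 _)] at this
    linarith
  · have mono : AntitoneOn (fun u => G u * u ^ (-gp)) (Ioi 0) := by
      apply antitoneOn_of_deriv_nonpos conv
      · intro u hu; exact (key gp u hu).continuousAt.continuousWithinAt
      · intro u hu; rw [interior_Ioi] at hu
        exact (key gp u hu).differentiableAt.differentiableWithinAt
      · intro u hu; rw [interior_Ioi] at hu
        rw [(key gp u hu).deriv]
        have h1 := (hb u hu).2
        rw [div_le_iff₀ (hpos u hu)] at h1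
        have : 0 < u ^ (-gp-1) := Real.rpow_pos_of_pos hu _
        apply mul_nonpos_of_nonneg_of_nonpos this.le; linarith
    have := mono (mem_Ioi.2 ht) (mem_Ioi.2 hlt) hle
    simp only [e] at this
    have hp : 0 < t ^ (-gp) := Real.rpow_pos_of_pos ht _
    have : G (l*t) * l ^ (-gp) ≤ G t := by
      refine le_of_mul_le_mul_right ?_ hp
      linarith
    rw [Real.rpow_neg hl0.le, ← div_eq_mul_inv, div_le_iff₀ (Real.rpow_pos_of_pos hl0 _)] at this
    linarith

/-- the minimal growth function -/
def AA (gm gp t : ℝ) : ℝ := min (t ^ gm) (t ^ gp)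

/-- collected facts about `G` -/
lemma G_facts (d : ℕ) (s : ℝ) (a g G : Rd d → Rd d → ℝ → ℝ) (gm gp : ℝ)
    (hG : GHyps d univ s a g G gm gp) (x y : Rd d) :
    G x y 0 = 0 ∧ (∀ t, 0 ≤ G x y t) ∧ (∀ t, G x y |t| = G x y t) ∧
    (∀ t l : ℝ, 1 ≤ l → l ^ gm * G x y t ≤ G x y (l * t) ∧ G x y (l * t) ≤ l ^ gp * G x y t) ∧
    (∀ t, G x y 1 * AA gm gp |t| ≤ G x y t) := by
  obtain ⟨-, -, -, -, ha, hg, -, -, hGi, h0, -, hc, -, hgm, hgp, -, hb⟩ := hG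
  have hG0 : G x y 0 = 0 := by rw [hGi x trivial y trivial]; simp
  have hev : ∀ t, G x y |t| = G x y t := by
    intro t; rw [hGi x trivial y trivial, hGi x trivial y trivial t, abs_abs]
  have hpos : ∀ t, 0 < t → 0 < G x y t := by
    intro t ht
    by_contra hcon
    have h1 := (hb x trivial y trivial t ht).1
    have h2 : 0 < a x y t * t ^ 2 := mul_pos (ha x trivial y trivial t ht) (by positivity)
    have := div_nonpos_of_nonneg_of_nonpos h2.le (not_lt.1 hcon)
    linarith
  have hd := aux_deriv (a x y) (g x y) (G x y) (hg x trivial y trivial) (hGi x trivial y trivial)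
    (h0 x trivial y trivial) (hc x trivial y trivial)
  have hs := aux_scale (a x y) (G x y) gm gp hd hpos (hb x trivial y trivial)
  have hnn : ∀ t, 0 ≤ G x y t := by
    intro t
    rw [← hev]
    rcases (abs_nonneg t).eq_or_lt with h | h
    · rw [← h, hG0]
    · exact (hpos _ h).le
  refine ⟨hG0, hnn, hev, ?_, ?_⟩
  · intro t l hl
    rcases (abs_nonneg t).eq_or_lt with h | h
    · have : t = 0 := abs_eq_zero.1 h.symm
      subst this; simp [hG0]
    · have := hs |t| l h hl
      rw [hev, show l * |t| = |l * t| by rw [abs_mul, abs_of_pos (show 0 < l by linarith)], hev] at this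
      exact this
  · intro t
    have h1 := hnn 1
    rw [← hev t]
    rcases (abs_nonneg t).eq_or_lt with h | h
    · rw [← h, hG0]
      simp [AA, Real.zero_rpow (by linarith : gm ≠ 0), Real.zero_rpow (by linarith : gp ≠ 0)]
    · rcases le_total 1 |t| with h2 | h2
      · have := (hs 1 |t| one_pos h2).1
        rw [mul_one] at this
        refine le_trans ?_ this
        rw [mul_comm]
        exact mul_le_mul_of_nonneg_right (min_le_left _ _) h1
      · have := (hs |t| |t|⁻¹ h ((one_le_inv₀ h).2 h2)).2
        rw [inv_mul_cancel₀ h.ne', Real.inv_rpow h.le, inv_mul_eq_div,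
          le_div_iff₀ (Real.rpow_pos_of_pos h _)] at this
        refine le_trans ?_ this
        exact mul_le_mul_of_nonneg_left (min_le_right _ _) h1

lemma AA_nonneg {gm gp t : ℝ} (ht : 0 ≤ t) : 0 ≤ AA gm gp t :=
  le_min (Real.rpow_nonneg ht _) (Real.rpow_nonneg ht _)

lemma AA_mono {gm gp t u : ℝ} (hgm : 0 ≤ gm) (hgp : 0 ≤ gp) (ht : 0 ≤ t) (h : t ≤ u) :
    AA gm gp t ≤ AA gm gp u :=
  min_le_min (Real.rpow_le_rpow ht h hgm) (Real.rpow_le_rpow ht h hgp)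

lemma AA_of_one_le {gm gp t : ℝ} (h : gm ≤ gp) (ht : 1 ≤ t) : AA gm gp t = t ^ gm :=
  min_eq_left (Real.rpow_le_rpow_of_exponent_le ht h)

lemma AA_of_le_one {gm gp t : ℝ} (h : gm ≤ gp) (hgm : 0 < gm) (h0 : 0 ≤ t) (ht : t ≤ 1) :
    AA gm gp t = t ^ gp := by
  rcases h0.eq_or_lt with h0 | h0
  · subst h0; simp [AA, Real.zero_rpow hgm.ne', Real.zero_rpow (hgm.trans_le h).ne']
  · exact min_eq_right (Real.rpow_le_rpow_of_exponent_ge h0 ht h)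

lemma AA_meas (gm gp : ℝ) : Measurable (AA gm gp) := by
  unfold AA; fun_prop

lemma rpow_split {q t θ : ℝ} (hq : 1 ≤ q) (hθ : 0 < θ) (h : θ ≤ t) :
    t ≤ θ ^ (1 - q) * t ^ q := by
  have ht : 0 < t := hθ.trans_le h
  have h1 : t ^ (1 - q) ≤ θ ^ (1 - q) := Real.rpow_le_rpow_of_nonpos hθ h (by linarith)
  calc t = t ^ (1 - q) * t ^ q := by rw [← Real.rpow_add ht]; simp
    _ ≤ _ := mul_le_mul_of_nonneg_right h1 (Real.rpow_nonneg ht.le _)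

lemma AA_split {gm gp t θ : ℝ} (hgm : 1 ≤ gm) (h : gm ≤ gp) (ht : 0 ≤ t) (hθ : 1 ≤ θ) :
    t ≤ θ + θ ^ (1 - gm) * AA gm gp t := by
  have h0 : 0 ≤ θ ^ (1 - gm) * AA gm gp t :=
    mul_nonneg (Real.rpow_nonneg (by linarith) _) (AA_nonneg ht)
  rcases le_total t θ with h1 | h1
  · linarith
  · rw [AA_of_one_le h (hθ.trans h1)]
    have := rpow_split hgm (by linarith) h1
    linarith

lemma diff_bound {gm gp s dd Δ ρ r θ : ℝ} (hgm : 1 ≤ gm) (h : gm ≤ gp) (hs : 0 < s) (hd : 0 < dd)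
    (hΔ : 0 ≤ Δ) (hρ : 0 ≤ ρ) (hρ0 : ρ = 0 → Δ = 0) (hr : ρ ≤ r) (hθ : 1 ≤ θ) :
    Δ ≤ r ^ s * θ + r ^ s * θ ^ (1 - gm) * r ^ dd * (AA gm gp (Δ / ρ ^ s) / ρ ^ dd) := by
  have hr0 : 0 ≤ r := hρ.trans hr
  have hθ0 : 0 ≤ θ ^ (1 - gm) := Real.rpow_nonneg (by linarith) _
  have hrs : 0 ≤ r ^ s := Real.rpow_nonneg hr0 _
  rcases hρ.eq_or_lt with h0 | h0
  · have hΔ0 := hρ0 h0.symm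
    subst hΔ0
    have : 0 ≤ AA gm gp (0 / ρ ^ s) := AA_nonneg (by simp)
    positivity
  · have hps : 0 < ρ ^ s := Real.rpow_pos_of_pos h0 _
    have hpd : 0 < ρ ^ dd := Real.rpow_pos_of_pos h0 _
    set t := Δ / ρ ^ s with ht
    have ht0 : 0 ≤ t := by positivity
    have hA : 0 ≤ AA gm gp t := AA_nonneg ht0
    have e : Δ = ρ ^ s * t := by rw [ht]; field_simp
    have h1 := AA_split hgm h ht0 hθ
    have h2 : ρ ^ s ≤ r ^ s := Real.rpow_le_rpow hρ hr hs.le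
    have h3 : ρ ^ dd ≤ r ^ dd := Real.rpow_le_rpow hρ hr hd.le
    have h4 : AA gm gp t ≤ r ^ dd * (AA gm gp t / ρ ^ dd) := by
      rw [mul_div_assoc', le_div_iff₀ hpd, mul_comm]
      exact mul_le_mul_of_nonneg_right h3 hA
    calc Δ = ρ ^ s * t := e
      _ ≤ r ^ s * t := mul_le_mul_of_nonneg_right h2 ht0
      _ ≤ r ^ s * (θ + θ ^ (1 - gm) * (r ^ dd * (AA gm gp t / ρ ^ dd))) := by
          apply mul_le_mul_of_nonneg_left _ hrs
          refine h1.trans ?_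
          have := mul_le_mul_of_nonneg_left h4 hθ0
          linarith
      _ = _ := by ring

/-- volume of the unit ball -/
def cB (d : ℕ) : ℝ := (volume (ball (0 : Rd d) 1)).toReal

lemma cB_pos (d : ℕ) : 0 < cB d :=
  ENNReal.toReal_pos (measure_ball_pos _ _ one_pos).ne' measure_ball_lt_top.ne

lemma vol_ball {d : ℕ} (x : Rd d) {r : ℝ} (hr : 0 < r) :
    volume (ball x r) = ENNReal.ofReal (r ^ (d:ℝ) * cB d) := by
  rw [Measure.addHaar_ball_of_pos _ _ hr, ENNReal.ofReal_mul (by positivity), cB,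
    ENNReal.ofReal_toReal measure_ball_lt_top.ne]
  simp

lemma avg {d : ℕ} (x : Rd d) {r W α β γ D F : ℝ} (hr : 0 < r)
    (hα : 0 ≤ α) (hβ : 0 ≤ β) (hγ : 0 ≤ γ) (hD : 0 ≤ D) (hF : 0 ≤ F)
    (k f : Rd d → ℝ) (hk : Measurable k) (hk0 : ∀ y, 0 ≤ k y) (hf0 : ∀ y, 0 ≤ f y)
    (hkD : ∫⁻ y, ENNReal.ofReal (k y) ≤ ENNReal.ofReal D)
    (hfF : ∫⁻ y, ENNReal.ofReal (f y) ≤ ENNReal.ofReal F)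
    (h : ∀ y ∈ ball x r, W ≤ α + β * k y + γ * f y) :
    W ≤ α + β * D / (r ^ (d:ℝ) * cB d) + γ * F / (r ^ (d:ℝ) * cB d) := by
  have hv : 0 < r ^ (d:ℝ) * cB d := mul_pos (Real.rpow_pos_of_pos hr _) (cB_pos d)
  set v := r ^ (d:ℝ) * cB d with hvdef
  have h1 : ENNReal.ofReal W * ENNReal.ofReal v ≤
      ENNReal.ofReal α * ENNReal.ofReal v + ENNReal.ofReal β * ENNReal.ofReal D
        + ENNReal.ofReal γ * ENNReal.ofReal F := by
    calc ENNReal.ofReal W * ENNReal.ofReal v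
        = ∫⁻ y in ball x r, ENNReal.ofReal W := by
          rw [setLIntegral_const, vol_ball x hr]
      _ ≤ ∫⁻ y in ball x r, (ENNReal.ofReal α + ENNReal.ofReal β * ENNReal.ofReal (k y)
            + ENNReal.ofReal γ * ENNReal.ofReal (f y)) := by
          refine setLIntegral_mono' measurableSet_ball ?_
          intro y hy
          rw [← ENNReal.ofReal_mul hβ, ← ENNReal.ofReal_mul hγ,
            ← ENNReal.ofReal_add hα (mul_nonneg hβ (hk0 y)),
            ← ENNReal.ofReal_add (add_nonneg hα (mul_nonneg hβ (hk0 y))) (mul_nonneg hγ (hf0 y))]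
          exact ENNReal.ofReal_le_ofReal (h y hy)
      _ = ENNReal.ofReal α * ENNReal.ofReal v 
            + ENNReal.ofReal β * (∫⁻ y in ball x r, ENNReal.ofReal (k y))
            + ENNReal.ofReal γ * ∫⁻ y in ball x r, ENNReal.ofReal (f y) := by
          rw [lintegral_add_left (by fun_prop), lintegral_add_left (by fun_prop),
            setLIntegral_const, vol_ball x hr, lintegral_const_mul' _ _ ENNReal.ofReal_ne_top,
            lintegral_const_mul' _ _ ENNReal.ofReal_ne_top]
      _ ≤ _ := by
          gcongr
          · exact (setLIntegral_le_lintegral _ _).trans hkD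
          · exact (setLIntegral_le_lintegral _ _).trans hfF
  rw [← ENNReal.ofReal_mul' hv.le, ← ENNReal.ofReal_mul hα, ← ENNReal.ofReal_mul hβ,
    ← ENNReal.ofReal_mul hγ, ← ENNReal.ofReal_add (by positivity) (by positivity),
    ← ENNReal.ofReal_add (by positivity) (by positivity),
    ENNReal.ofReal_le_ofReal_iff (by positivity)] at h1
  rw [← le_div_iff₀ hv] at h1
  refine h1.trans (le_of_eq ?_)
  field_simp

/-- the kernel -/
def kern {d : ℕ} (gm gp s : ℝ) (w : Rd d → ℝ) (x y : Rd d) : ℝ :=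
  AA gm gp (|w x - w y| / dist x y ^ s) / dist x y ^ (d:ℝ)

lemma kern_nonneg {d : ℕ} (gm gp s : ℝ) (w : Rd d → ℝ) (x y : Rd d) : 0 ≤ kern gm gp s w x y := by
  unfold kern
  have : 0 ≤ AA gm gp (|w x - w y| / dist x y ^ s) := AA_nonneg (by positivity)
  positivity

lemma kern_meas {d : ℕ} (gm gp s : ℝ) (w : Rd d → ℝ) (hw : Measurable w) :
    Measurable (fun z : Rd d × Rd d => kern gm gp s w z.1 z.2) := by
  unfold kern
  have := AA_meas gm gp
  fun_prop

lemma kern_meas' {d : ℕ} (gm gp s : ℝ) (w : Rd d → ℝ) (hw : Measurable w) (x : Rd d) :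
    Measurable (kern gm gp s w x) := by
  have := AA_meas gm gp
  unfold kern
  fun_prop

/-- truncated power -/
def ff (q t : ℝ) : ℝ := if 4 ≤ t then t ^ q else 0

lemma ff_nonneg {q t : ℝ} : 0 ≤ ff q t := by
  unfold ff; split_ifs with h
  · exact Real.rpow_nonneg (by linarith) _
  · exact le_rfl

lemma ff_meas (q : ℝ) : Measurable (ff q) := by
  unfold ff
  exact Measurable.ite measurableSet_Ici (by fun_prop) measurable_const

lemma pt1 {d : ℕ} (hd : 0 < (d:ℝ)) {gm gp s q D F N : ℝ} (hgm : 1 ≤ gm) (h : gm ≤ gp) (hs : 0 < s)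
    (hq : 1 ≤ q) (w : Rd d → ℝ) (hw : Measurable w) (hw0 : ∀ x, 0 ≤ w x) (x : Rd d)
    (hD : 1 ≤ D) (hkD : ∫⁻ y, ENNReal.ofReal (kern gm gp s w x y) ≤ ENNReal.ofReal D)
    (hF0 : 0 ≤ F) (hfF : ∫⁻ y, ENNReal.ofReal (ff q (w y)) ≤ ENNReal.ofReal F)
    (hN : 4 ≤ N) (hFN : F ≤ N ^ q) (r : ℝ) (hr : 0 < r) (hr1 : r ≤ 1) :
    w x ≤ (1 + 1 / cB d) * (r ^ s * D ^ (1/gm)) + (1 + 1 / cB d) * (N * r ^ (-(d:ℝ)/q)) := by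
  have hc := cB_pos d
  set θ := D ^ (1/gm) with hθ
  have hθ1 : 1 ≤ θ := Real.one_le_rpow hD (by positivity)
  have hθg : θ ^ gm = D := by
    rw [hθ, ← Real.rpow_mul (by linarith)]; 
    rw [one_div_mul_cancel (by linarith), Real.rpow_one]
  set η := N * r ^ (-(d:ℝ)/q) with hη
  have hrq : 1 ≤ r ^ (-(d:ℝ)/q) := Real.one_le_rpow_of_pos_of_le_one_of_nonpos hr hr1 
    (by rw [neg_div]; simp; positivity)
  have hη4 : 4 ≤ η := by rw [hη]; nlinarith
  have hηq : η ^ q = N ^ q / r ^ (d:ℝ) := by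
    rw [hη, Real.mul_rpow (by linarith) (by positivity), ← Real.rpow_mul hr.le,
      div_mul_cancel₀ _ (by linarith), Real.rpow_neg hr.le]; rfl
  have hθ0 : 0 < θ := by linarith
  have hη0 : 0 < η := by linarith
  have hrd : 0 < r ^ (d:ℝ) := Real.rpow_pos_of_pos hr _
  have := avg x (W := w x) (α := r ^ s * θ + η) (β := r ^ s * θ ^ (1 - gm) * r ^ (d:ℝ))
    (γ := η ^ (1 - q)) hr (by positivity) (by positivity) (by positivity) (by linarith) hF0
    (kern gm gp s w x) (fun y => ff q (w y))
    (kern_meas' gm gp s w hw x)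
    (kern_nonneg gm gp s w x) (fun y => ff_nonneg) hkD hfF ?_
  · refine this.trans ?_
    have e1 : r ^ s * θ ^ (1 - gm) * r ^ (d:ℝ) * D / (r ^ (d:ℝ) * cB d) = 1 / cB d * (r ^ s * θ) := by
      have : θ ^ (1 - gm) * D = θ := by
        rw [← hθg, ← Real.rpow_add hθ0]; simp
      calc _ = (θ ^ (1 - gm) * D) * r ^ s / cB d := by field_simp
        _ = _ := by rw [this]; ring
    have e2 : η ^ (1 - q) * F / (r ^ (d:ℝ) * cB d) ≤ 1 / cB d * η := by
      have : η ^ (1 - q) * η ^ q = η := by rw [← Real.rpow_add hη0]; simp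
      calc _ ≤ η ^ (1 - q) * N ^ q / (r ^ (d:ℝ) * cB d) := by gcongr
        _ = (η ^ (1 - q) * η ^ q) / cB d := by rw [hηq]; field_simp
        _ = _ := by rw [this]; ring
    rw [e1]; linarith
  · intro y hy
    have h1 := diff_bound (dd := (d:ℝ)) (Δ := |w x - w y|) (ρ := dist x y) (r := r) (θ := θ) hgm h hs
      hd (abs_nonneg _) dist_nonneg (fun h0 => by rw [dist_eq_zero.1 h0]; simp) 
      (by rw [dist_comm]; exact (mem_ball.1 hy).le) hθ1
    have h2 : w y ≤ η + η ^ (1 - q) * ff q (w y) := by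
      rcases le_total (w y) η with h3 | h3
      · have : 0 ≤ η ^ (1 - q) * ff q (w y) := mul_nonneg (by positivity) ff_nonneg
        linarith
      · have := rpow_split hq hη0 h3
        rw [ff, if_pos (hη4.trans h3)]
        linarith
    have h3 := le_abs_self (w x - w y)
    unfold kern
    linarith

lemma pt2 {d : ℕ} (hd : 0 < (d:ℝ)) {gm gp s D H : ℝ} (hgm : 1 ≤ gm) (h : gm ≤ gp) (hs : 0 < s)
    (w : Rd d → ℝ) (hw : Measurable w) (hw0 : ∀ x, 0 ≤ w x) (x : Rd d)
    (hD : 1 ≤ D) (hkD : ∫⁻ y, ENNReal.ofReal (kern gm gp s w x y) ≤ ENNReal.ofReal D)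
    (hH0 : 0 ≤ H) (hfH : ∫⁻ y, ENNReal.ofReal (AA gm gp (w y)) ≤ ENNReal.ofReal H) :
    w x ≤ (2 + 1 / cB d + H / cB d) * D ^ (1/gm) := by
  have hc := cB_pos d
  set θ := D ^ (1/gm) with hθ
  have hθ1 : 1 ≤ θ := Real.one_le_rpow hD (by positivity)
  have hθg : θ ^ gm = D := by
    rw [hθ, ← Real.rpow_mul (by linarith)]; 
    rw [one_div_mul_cancel (by linarith), Real.rpow_one]
  have hθ0 : 0 < θ := by linarith
  have := avg x (W := w x) (α := θ + 1) (β := θ ^ (1 - gm))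
    (γ := 1) one_pos (by positivity) (by positivity) (by positivity) (by linarith) hH0
    (kern gm gp s w x) (fun y => AA gm gp (w y))
    (kern_meas' gm gp s w hw x)
    (kern_nonneg gm gp s w x) (fun y => AA_nonneg (hw0 y)) hkD hfH ?_
  · refine this.trans ?_
    have e1 : θ ^ (1 - gm) * D = θ := by
        rw [← hθg, ← Real.rpow_add hθ0]; simp
    rw [e1, Real.one_rpow, one_mul, one_mul]
    have : H / cB d ≤ H / cB d * θ := le_mul_of_one_le_right (by positivity) hθ1
    have e : (2 + 1 / cB d + H / cB d) * θ = 2 * θ + θ / cB d + H / cB d * θ := by ring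
    rw [e]; linarith
  · intro y hy
    have h1 := diff_bound (dd := (d:ℝ)) (Δ := |w x - w y|) (ρ := dist x y) (r := 1) (θ := θ) hgm h hs
      hd (abs_nonneg _) dist_nonneg (fun h0 => by rw [dist_eq_zero.1 h0]; simp) 
      (by rw [dist_comm]; exact (mem_ball.1 hy).le) hθ1
    have h2 := AA_split hgm h (hw0 y) le_rfl
    have h3 := le_abs_self (w x - w y)
    simp only [Real.one_rpow, one_mul, mul_one] at h1 h2
    unfold kern
    linarith

lemma pt {d : ℕ} (hd : 0 < (d:ℝ)) {gm gp s q D F N H : ℝ} (hgm : 1 ≤ gm) (h : gm ≤ gp) (hs : 0 < s)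
    (hgq : gm ≤ q) (hqe : 1 / gm - s / d = 1 / q)
    (w : Rd d → ℝ) (hw : Measurable w) (hw0 : ∀ x, 0 ≤ w x) (x : Rd d)
    (hD : 1 ≤ D) (hkD : ∫⁻ y, ENNReal.ofReal (kern gm gp s w x y) ≤ ENNReal.ofReal D)
    (hF0 : 0 ≤ F) (hfF : ∫⁻ y, ENNReal.ofReal (ff q (w y)) ≤ ENNReal.ofReal F)
    (hN : 4 ≤ N) (hFN : F ≤ N ^ q)
    (hH0 : 0 ≤ H) (hfH : ∫⁻ y, ENNReal.ofReal (AA gm gp (w y)) ≤ ENNReal.ofReal H) :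
    w x ^ q ≤ (2 + 2 / cB d + H / cB d) ^ q * (D * N ^ (q - gm)) := by
  have hc := cB_pos d
  have hN0 : 0 < N := by linarith
  have hD0 : 0 < D := by linarith
  have hgm0 : 0 < gm := by linarith
  have hq0 : 0 < q := by linarith
  -- reduce to a bound by Z with Z ^ q ≤ D * N^(q-gm)
  suffices hZ : ∃ Z, 0 ≤ Z ∧ w x ≤ (2 + 2 / cB d + H / cB d) * Z ∧ Z ^ q ≤ D * N ^ (q - gm) by
    obtain ⟨Z, hZ0, h1, h2⟩ := hZ
    calc w x ^ q ≤ ((2 + 2 / cB d + H / cB d) * Z) ^ q := Real.rpow_le_rpow (hw0 x) h1 hq0.le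
      _ = (2 + 2 / cB d + H / cB d) ^ q * Z ^ q := Real.mul_rpow (by positivity) hZ0
      _ ≤ _ := by gcongr
  rcases le_total (N ^ gm) D with hcase | hcase
  · set r := (N ^ gm / D) ^ (1 / (d:ℝ)) with hr
    have hr0 : 0 < r := by positivity
    have hr1 : r ≤ 1 := Real.rpow_le_one (by positivity) ((div_le_one hD0).2 hcase) (by positivity)
    have key := pt1 hd hgm h hs (by linarith) w hw hw0 x hD hkD hF0 hfF hN hFN r hr0 hr1
    have hrp : ∀ z : ℝ, r ^ z = N ^ (gm * (z / d)) * D ^ (-(z / d)) := by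
      intro z
      rw [hr, ← Real.rpow_mul (by positivity), Real.div_rpow (by positivity) hD0.le,
        ← Real.rpow_mul hN0.le, Real.rpow_neg hD0.le, ← div_eq_mul_inv]
      congr 2 <;> ring
    refine ⟨D ^ (1/q) * N ^ (gm * s / d), by positivity, ?_, ?_⟩
    · have e1 : r ^ s * D ^ (1/gm) = D ^ (1/q) * N ^ (gm * s / d) := by
        rw [hrp, mul_assoc, ← Real.rpow_add hD0, mul_comm, ← hqe]
        congr 2 <;> ring
      have e2 : N * r ^ (-(d:ℝ)/q) = D ^ (1/q) * N ^ (gm * s / d) := by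
        have ea : gm * (-(d:ℝ)/q/d) + 1 = gm * s / d := by
          have : gm * (1/gm - s/d) = gm * (1/q) := by rw [hqe]
          field_simp at this ⊢
          linarith
        have eb : -(-(d:ℝ)/q/d) = 1 / q := by field_simp
        rw [hrp, eb, ← ea, Real.rpow_add_one hN0.ne']; ring
      rw [e1, e2] at key
      set Z := D ^ (1/q) * N ^ (gm * s / d)
      have : 0 ≤ H / cB d * Z := by positivity
      have e : (2 + 2 / cB d + H / cB d) * Z = (1 + 1 / cB d) * Z + (1 + 1 / cB d) * Z + H / cB d * Z := by ring
      linarith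
    · rw [Real.mul_rpow (by positivity) (by positivity), ← Real.rpow_mul hD0.le,
        ← Real.rpow_mul hN0.le, one_div_mul_cancel hq0.ne', Real.rpow_one]
      have : gm * s / d * q = q - gm := by
        have : gm * q * (1/gm - s/d) = gm * q * (1/q) := by rw [hqe]
        field_simp at this ⊢
        linarith
      rw [this]
  · have key := pt2 hd hgm h hs w hw hw0 x hD hkD hH0 hfH
    refine ⟨D ^ (1/gm), by positivity, key.trans ?_, ?_⟩
    · gcongr; norm_num
    · have : D ^ (1/gm) ≤ N := by
        calc D ^ (1/gm) ≤ (N ^ gm) ^ (1/gm) := Real.rpow_le_rpow hD0.le hcase (by positivity)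
          _ = N := by rw [← Real.rpow_mul hN0.le, mul_one_div_cancel hgm0.ne', Real.rpow_one]
      have e : (D ^ (1/gm)) ^ q = D * (D ^ (1/gm)) ^ (q - gm) := by
        have : (D ^ (1/gm)) ^ gm = D := by
          rw [← Real.rpow_mul hD0.le, one_div_mul_cancel hgm0.ne', Real.rpow_one]
        nth_rewrite 2 [← this]
        rw [← Real.rpow_add (by positivity)]; congr 1; ring
      rw [e]
      gcongr

lemma ff_le {gm gp q k t : ℝ} (hgm : 1 ≤ gm) (h : gm ≤ gp) (hq : 0 ≤ q) (ht : 0 ≤ t) (hk : t ≤ k) :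
    ff q t ≤ k ^ q * AA gm gp t := by
  have hA : 0 ≤ AA gm gp t := AA_nonneg ht
  have hk0 : 0 ≤ k := ht.trans hk
  unfold ff
  split_ifs with h4
  · have h1 : 1 ≤ AA gm gp t := by
      rw [AA_of_one_le h (by linarith)]
      exact Real.one_le_rpow (by linarith) (by linarith)
    have h2 : t ^ q ≤ k ^ q := Real.rpow_le_rpow ht hk hq
    have h3 : 0 ≤ k ^ q := by positivity
    nlinarith
  · positivity

/-- the constant -/
def CS (d : ℕ) (gm q K H : ℝ) : ℝ :=
  ((2 + 2 / cB d + H / cB d) ^ q * (K + H) + 4 ^ q) ^ (q / gm)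

lemma sob_bdd {d : ℕ} (hd : 0 < (d:ℝ)) {gm gp s q k K H : ℝ} (hgm : 1 ≤ gm) (h : gm ≤ gp) (hs : 0 < s)
    (hgq : gm ≤ q) (hqe : 1 / gm - s / d = 1 / q)
    (w : Rd d → ℝ) (hw : Measurable w) (hw0 : ∀ x, 0 ≤ w x) (hwk : ∀ x, w x ≤ k)
    (hK0 : 0 ≤ K) (hH0 : 0 ≤ H)
    (hK : ∫⁻ x, ∫⁻ y, ENNReal.ofReal (kern gm gp s w x y) ≤ ENNReal.ofReal K)
    (hH : ∫⁻ y, ENNReal.ofReal (AA gm gp (w y)) ≤ ENNReal.ofReal H) :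
    ∫⁻ y, ENNReal.ofReal (ff q (w y)) ≤ ENNReal.ofReal (CS d gm q K H) := by
  have hc := cB_pos d
  have hq0 : 0 < q := by linarith
  have hgm0 : 0 < gm := by linarith
  have hk0 : 0 ≤ k := (hw0 0).trans (hwk 0)
  have hfin : ∫⁻ y, ENNReal.ofReal (ff q (w y)) ≠ ⊤ := by
    refine ne_top_of_le_ne_top (b := ENNReal.ofReal (k ^ q) * ENNReal.ofReal H)
      (ENNReal.mul_ne_top ENNReal.ofReal_ne_top ENNReal.ofReal_ne_top) ?_
    calc ∫⁻ y, ENNReal.ofReal (ff q (w y)) 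
        ≤ ∫⁻ y, ENNReal.ofReal (k ^ q) * ENNReal.ofReal (AA gm gp (w y)) := by
          refine lintegral_mono fun y => ?_
          rw [← ENNReal.ofReal_mul (by positivity)]
          exact ENNReal.ofReal_le_ofReal (ff_le hgm h hq0.le (hw0 y) (hwk y))
      _ ≤ _ := by
          rw [lintegral_const_mul' _ _ ENNReal.ofReal_ne_top]
          gcongr
  set F := (∫⁻ y, ENNReal.ofReal (ff q (w y))).toReal with hF
  have hF0 : 0 ≤ F := ENNReal.toReal_nonneg
  have hFe : ∫⁻ y, ENNReal.ofReal (ff q (w y)) = ENNReal.ofReal F := (ENNReal.ofReal_toReal hfin).symm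
  set N := (F + 4 ^ q) ^ (1/q) with hN
  have h4q : (0:ℝ) < 4 ^ q := by positivity
  have hNq : N ^ q = F + 4 ^ q := by
    rw [hN, ← Real.rpow_mul (by positivity), one_div_mul_cancel hq0.ne', Real.rpow_one]
  have hN0 : 0 < N := by positivity
  have hN4 : 4 ≤ N := by
    rw [← Real.rpow_le_rpow_iff (by norm_num) hN0.le hq0, hNq]; linarith
  set M := (2 + 2 / cB d + H / cB d) ^ q with hM
  have hM0 : 0 < M := by positivity
  have hP0 : 0 < M * N ^ (q - gm) := by positivity
  have hpt : ∀ x, ENNReal.ofReal (ff q (w x)) ≤ ENNReal.ofReal (M * N ^ (q - gm)) *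
      ((∫⁻ y, ENNReal.ofReal (kern gm gp s w x y)) + ENNReal.ofReal (AA gm gp (w x))) := by
    intro x
    by_cases h4 : 4 ≤ w x
    swap
    · simp [ff, h4]
    by_cases hT : ∫⁻ y, ENNReal.ofReal (kern gm gp s w x y) = ⊤
    · rw [hT, top_add, ENNReal.mul_top (ENNReal.ofReal_pos.2 hP0).ne']
      exact le_top
    set D := (∫⁻ y, ENNReal.ofReal (kern gm gp s w x y)).toReal with hD
    have hD0 : 0 ≤ D := ENNReal.toReal_nonneg
    have hDe : ∫⁻ y, ENNReal.ofReal (kern gm gp s w x y) = ENNReal.ofReal D :=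
      (ENNReal.ofReal_toReal hT).symm
    have h1 : 1 ≤ AA gm gp (w x) := by
      rw [AA_of_one_le h (by linarith)]
      exact Real.one_le_rpow (by linarith) (by linarith)
    have key := pt hd hgm h hs hgq hqe w hw hw0 x (D := D + AA gm gp (w x)) (by linarith)
      (by rw [hDe]; exact ENNReal.ofReal_le_ofReal (by linarith)) hF0 hFe.le hN4
      (by rw [hNq]; linarith) hH0 hH
    rw [hDe, ← ENNReal.ofReal_add hD0 (by linarith), ← ENNReal.ofReal_mul hP0.le]
    apply ENNReal.ofReal_le_ofReal
    rw [ff, if_pos h4]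
    refine key.trans (le_of_eq ?_)
    ring
  have hint : ENNReal.ofReal F ≤ ENNReal.ofReal (M * N ^ (q - gm)) * (ENNReal.ofReal K + ENNReal.ofReal H) := by
    rw [← hFe]
    refine (lintegral_mono hpt).trans ?_
    rw [lintegral_const_mul' _ _ ENNReal.ofReal_ne_top, lintegral_add_right]
    · gcongr
    · exact ((AA_meas gm gp).comp hw).ennreal_ofReal
  rw [← ENNReal.ofReal_add hK0 hH0, ← ENNReal.ofReal_mul hP0.le,
    ENNReal.ofReal_le_ofReal_iff (by positivity)] at hint
  rw [hFe]
  apply ENNReal.ofReal_le_ofReal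
  have hNe : N ^ q = N ^ gm * N ^ (q - gm) := by
    rw [← Real.rpow_add hN0]; congr 1; ring
  have hN1 : 1 ≤ N ^ (q - gm) := Real.one_le_rpow (by linarith) (by linarith)
  have hB : N ^ gm ≤ M * (K + H) + 4 ^ q := by
    refine le_of_mul_le_mul_right ?_ (lt_of_lt_of_le one_pos hN1)
    rw [← hNe, hNq]
    nlinarith
  calc F ≤ N ^ q := by rw [hNq]; linarith
    _ = (N ^ gm) ^ (q / gm) := by
      rw [← Real.rpow_mul hN0.le, mul_div_cancel₀ _ hgm0.ne']
    _ ≤ _ := Real.rpow_le_rpow (by positivity) hB (by positivity)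

lemma sob {d : ℕ} (hd : 0 < (d:ℝ)) {gm gp s q K H : ℝ} (hgm : 1 ≤ gm) (h : gm ≤ gp) (hs : 0 < s)
    (hgq : gm ≤ q) (hqe : 1 / gm - s / d = 1 / q)
    (w : Rd d → ℝ) (hw : Measurable w)
    (hK0 : 0 ≤ K) (hH0 : 0 ≤ H)
    (hK : ∫⁻ x, ∫⁻ y, ENNReal.ofReal (kern gm gp s w x y) ≤ ENNReal.ofReal K)
    (hH : ∫⁻ y, ENNReal.ofReal (AA gm gp |w y|) ≤ ENNReal.ofReal H) :
    ∫⁻ y, ENNReal.ofReal (ff q |w y|) ≤ ENNReal.ofReal (CS d gm q K H) := by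
  have hgm0 : 0 ≤ gm := by linarith
  have hgp0 : 0 ≤ gp := by linarith
  have hk : ∀ k : ℕ, ∫⁻ y, ENNReal.ofReal (ff q (min |w y| k)) ≤ ENNReal.ofReal (CS d gm q K H) := by
    intro k
    refine sob_bdd hd hgm h hs hgq hqe (fun y => min |w y| k) (by fun_prop) (fun y => by positivity)
      (k := k) (fun y => min_le_right _ _) hK0 hH0 ?_ ?_
    · refine le_trans (lintegral_mono fun x => lintegral_mono fun y => ?_) hK
      apply ENNReal.ofReal_le_ofReal
      unfold kern
      have h1 : |min |w x| (k:ℝ) - min |w y| k| ≤ |w x - w y| :=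
        (abs_min_sub_min_le_max _ _ _ _).trans (by
          simp only [sub_self, abs_zero]
          exact max_le (abs_abs_sub_abs_le _ _) (abs_nonneg _))
      gcongr
      apply AA_mono hgm0 hgp0 (by positivity)
      gcongr
    · refine le_trans (lintegral_mono fun y => ?_) hH
      apply ENNReal.ofReal_le_ofReal
      exact AA_mono hgm0 hgp0 (by positivity) (min_le_left _ _)
  have hlim : ∀ y, liminf (fun k : ℕ => ENNReal.ofReal (ff q (min |w y| k))) atTop
      = ENNReal.ofReal (ff q |w y|) := by
    intro y
    apply Tendsto.liminf_eq
    refine tendsto_const_nhds.congr' ?_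
    filter_upwards [eventually_ge_atTop ⌈|w y|⌉₊] with k hk
    rw [min_eq_left (Nat.ceil_le.1 hk)]
  calc ∫⁻ y, ENNReal.ofReal (ff q |w y|) 
      = ∫⁻ y, liminf (fun k : ℕ => ENNReal.ofReal (ff q (min |w y| k))) atTop := by simp_rw [hlim]
    _ ≤ liminf (fun k : ℕ => ∫⁻ y, ENNReal.ofReal (ff q (min |w y| k))) atTop := by
      apply lintegral_liminf_le
      intro k
      exact ((ff_meas q).comp (by fun_prop)).ennreal_ofReal
    _ ≤ liminf (fun k : ℕ => ENNReal.ofReal (CS d gm q K H)) atTop :=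
      liminf_le_liminf (Eventually.of_forall hk)
    _ = _ := by simp

lemma emb {d : ℕ} (hd : 0 < (d:ℝ)) {gm gp s q C₁ V₀ : ℝ} (hgm : 1 ≤ gm) (h : gm ≤ gp) (hs : 0 < s)
    (hgq : gm ≤ q) (hqe : 1 / gm - s / d = 1 / q) (hC : 0 < C₁) (hV0 : 0 < V₀)
    (G : Rd d → Rd d → ℝ → ℝ) (V : Rd d → ℝ) (hV : ∀ x, V₀ ≤ V x)
    (hlow : ∀ x y t, C₁ * AA gm gp |t| ≤ G x y t)
    (w : Rd d → ℝ) (hw : Measurable w) (hf : fracModular univ s G w ≤ 1) (hwm : wModular G V w ≤ 1)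
    (e : Rd d → ℝ) (he : ∀ x, gp ≤ e x ∧ e x ≤ q) :
    ∫⁻ x, ENNReal.ofReal (|w x| ^ e x) ≤ 
      ENNReal.ofReal (4 ^ q * (1 / (V₀ * C₁)) + CS d gm q (1 / C₁) (1 / (V₀ * C₁))) := by
  have hc := cB_pos d
  have hK : ∫⁻ x, ∫⁻ y, ENNReal.ofReal (kern gm gp s w x y) ≤ ENNReal.ofReal (1 / C₁) := by
    have : ∫⁻ x, ∫⁻ y, ENNReal.ofReal (kern gm gp s w x y) ≤ ENNReal.ofReal (1 / C₁) * fracModular univ s G w := by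
      unfold fracModular
      rw [← lintegral_const_mul' _ _ ENNReal.ofReal_ne_top]
      simp only [Measure.restrict_univ]
      refine lintegral_mono fun x => ?_
      rw [← lintegral_const_mul' _ _ ENNReal.ofReal_ne_top]
      refine lintegral_mono fun y => ?_
      rw [← ENNReal.ofReal_mul (by positivity)]
      apply ENNReal.ofReal_le_ofReal
      unfold kern
      have h1 := hlow x y ((w x - w y) / dist x y ^ s)
      rw [abs_div, abs_of_nonneg (show 0 ≤ dist x y ^ s by positivity)] at h1
      rw [mul_div_assoc']
      gcongr
      rw [one_div, inv_mul_eq_div, le_div_iff₀ hC]; linarith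
    refine this.trans ?_
    exact mul_le_of_le_one_right' hf
  have hH : ∫⁻ y, ENNReal.ofReal (AA gm gp |w y|) ≤ ENNReal.ofReal (1 / (V₀ * C₁)) := by
    have : ∫⁻ y, ENNReal.ofReal (AA gm gp |w y|) ≤ ENNReal.ofReal (1 / (V₀ * C₁)) * wModular G V w := by
      unfold wModular
      rw [← lintegral_const_mul' _ _ ENNReal.ofReal_ne_top]
      refine lintegral_mono fun x => ?_
      rw [← ENNReal.ofReal_mul (by positivity)]
      apply ENNReal.ofReal_le_ofReal
      have h1 := hlow x x |w x|
      rw [abs_abs] at h1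
      have h2 : 0 ≤ AA gm gp |w x| := AA_nonneg (abs_nonneg _)
      rw [one_div, inv_mul_eq_div, le_div_iff₀ (by positivity)]
      calc _ = V₀ * (C₁ * AA gm gp |w x|) := by ring
        _ ≤ V x * G x x |w x| := mul_le_mul (hV x) h1 (by positivity) (hV0.le.trans (hV x))
    exact this.trans (mul_le_of_le_one_right' hwm)
  have hS := sob hd hgm h hs hgq hqe w hw (by positivity) (by positivity) hK hH
  have hCS : 0 ≤ CS d gm q (1 / C₁) (1 / (V₀ * C₁)) := by unfold CS; positivity
  rw [ENNReal.ofReal_add (by positivity) hCS, ENNReal.ofReal_mul (by positivity)]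
  calc ∫⁻ x, ENNReal.ofReal (|w x| ^ e x)
      ≤ ∫⁻ x, (ENNReal.ofReal (4 ^ q) * ENNReal.ofReal (AA gm gp |w x|) + ENNReal.ofReal (ff q |w x|)) := by
        refine lintegral_mono fun x => ?_
        have h2 : 0 ≤ AA gm gp |w x| := AA_nonneg (abs_nonneg _)
        have h3 : 0 ≤ ff q |w x| := ff_nonneg
        rw [← ENNReal.ofReal_mul (by positivity), ← ENNReal.ofReal_add (by positivity) ff_nonneg]
        apply ENNReal.ofReal_le_ofReal
        have h4 : (1:ℝ) ≤ 4 ^ q := Real.one_le_rpow (by norm_num) (by linarith)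
        obtain ⟨he1, he2⟩ := he x
        rcases le_total |w x| 1 with h5 | h5
        · have : |w x| ^ e x ≤ AA gm gp |w x| := by
            rw [AA_of_le_one h (by linarith) (abs_nonneg _) h5]
            exact Real.rpow_le_rpow_of_exponent_ge_of_imp (abs_nonneg _) h5 he1 (fun _ _ => by linarith)
          nlinarith
        · have h6 : |w x| ^ e x ≤ |w x| ^ q := Real.rpow_le_rpow_of_exponent_le h5 he2
          by_cases h7 : 4 ≤ |w x|
          · have : ff q |w x| = |w x| ^ q := if_pos h7
            have : 0 ≤ 4 ^ q * AA gm gp |w x| := by positivity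
            linarith
          · have h8 : |w x| ^ q ≤ 4 ^ q := Real.rpow_le_rpow (abs_nonneg _) (not_le.1 h7).le (by linarith)
            have h1 : 1 ≤ AA gm gp |w x| := by
              rw [AA_of_one_le h h5]
              exact Real.one_le_rpow h5 (by linarith)
            nlinarith
    _ ≤ _ := by
        have hm : Measurable fun x => ENNReal.ofReal (ff q |w x|) := by
          have := ff_meas q
          fun_prop
        rw [lintegral_add_right _ hm,
          lintegral_const_mul' _ _ ENNReal.ofReal_ne_top]
        gcongr

lemma frac_scale {d : ℕ} {s gm : ℝ} (G : Rd d → Rd d → ℝ → ℝ)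
    (hs : ∀ x y (t l : ℝ), 1 ≤ l → l ^ gm * G x y t ≤ G x y (l * t))
    (u : Rd d → ℝ) {l : ℝ} (hl : 1 ≤ l) :
    ENNReal.ofReal (l ^ gm) * fracModular univ s G (fun x => u x / l) ≤ fracModular univ s G u := by
  have hl0 : 0 < l := by linarith
  unfold fracModular
  rw [← lintegral_const_mul' _ _ ENNReal.ofReal_ne_top]
  simp only [Measure.restrict_univ]
  refine lintegral_mono fun x => ?_
  rw [← lintegral_const_mul' _ _ ENNReal.ofReal_ne_top]
  refine lintegral_mono fun y => ?_
  rw [← ENNReal.ofReal_mul (by positivity)]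
  apply ENNReal.ofReal_le_ofReal
  have h1 := hs x y ((u x / l - u y / l) / dist x y ^ s) l hl
  have e : l * ((u x / l - u y / l) / dist x y ^ s) = (u x - u y) / dist x y ^ s := by
    rw [← sub_div, mul_div_assoc', mul_div_cancel₀ _ hl0.ne']
  rw [e] at h1
  rw [mul_div_assoc']
  gcongr

lemma frac_scale' {d : ℕ} {s gp : ℝ} (G : Rd d → Rd d → ℝ → ℝ)
    (hs : ∀ x y (t l : ℝ), 1 ≤ l → G x y (l * t) ≤ l ^ gp * G x y t)
    (u : Rd d → ℝ) {l : ℝ} (hl : 1 ≤ l) :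
    fracModular univ s G u ≤ ENNReal.ofReal (l ^ gp) * fracModular univ s G (fun x => u x / l) := by
  have hl0 : 0 < l := by linarith
  unfold fracModular
  rw [← lintegral_const_mul' _ _ ENNReal.ofReal_ne_top]
  simp only [Measure.restrict_univ]
  refine lintegral_mono fun x => ?_
  rw [← lintegral_const_mul' _ _ ENNReal.ofReal_ne_top]
  refine lintegral_mono fun y => ?_
  rw [← ENNReal.ofReal_mul (by positivity)]
  apply ENNReal.ofReal_le_ofReal
  have h1 := hs x y ((u x / l - u y / l) / dist x y ^ s) l hl
  have e : l * ((u x / l - u y / l) / dist x y ^ s) = (u x - u y) / dist x y ^ s := by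
    rw [← sub_div, mul_div_assoc', mul_div_cancel₀ _ hl0.ne']
  rw [e] at h1
  rw [mul_div_assoc']
  gcongr

lemma w_scale {d : ℕ} {gm : ℝ} (G : Rd d → Rd d → ℝ → ℝ) (V : Rd d → ℝ) (hV : ∀ x, 0 ≤ V x)
    (hs : ∀ x y (t l : ℝ), 1 ≤ l → l ^ gm * G x y t ≤ G x y (l * t))
    (u : Rd d → ℝ) {l : ℝ} (hl : 1 ≤ l) :
    ENNReal.ofReal (l ^ gm) * wModular G V (fun x => u x / l) ≤ wModular G V u := by
  have hl0 : 0 < l := by linarith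
  unfold wModular
  rw [← lintegral_const_mul' _ _ ENNReal.ofReal_ne_top]
  refine lintegral_mono fun x => ?_
  rw [← ENNReal.ofReal_mul (by positivity)]
  apply ENNReal.ofReal_le_ofReal
  have h1 := hs x x |u x / l| l hl
  have e : l * |u x / l| = |u x| := by
    rw [abs_div, abs_of_pos hl0, mul_div_cancel₀ _ hl0.ne']
  rw [e] at h1
  calc _ = V x * (l ^ gm * G x x |u x / l|) := by ring
    _ ≤ _ := mul_le_mul_of_nonneg_left h1 (hV x)

lemma le_one_of_scale {c : ℝ} {A B : ℝ≥0∞} (hc : 0 < c) (h : ENNReal.ofReal c * A ≤ B)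
    (hB : B ≠ ⊤) (hBc : B.toReal ≤ c) : A ≤ 1 := by
  have h1 : B ≤ ENNReal.ofReal c := by
    rw [← ENNReal.ofReal_toReal hB]; exact ENNReal.ofReal_le_ofReal hBc
  have h2 : ENNReal.ofReal c * A ≤ ENNReal.ofReal c * 1 := by rw [mul_one]; exact h.trans h1
  exact (ENNReal.mul_le_mul_iff_right (ENNReal.ofReal_pos.2 hc).ne' ENNReal.ofReal_ne_top).1 h2

lemma frac_fin {d : ℕ} {s gm gp : ℝ} (hgm : 0 < gm) (G : Rd d → Rd d → ℝ → ℝ)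
    (hs : ∀ x y (t l : ℝ), 1 ≤ l → l ^ gm * G x y t ≤ G x y (l * t) ∧ G x y (l * t) ≤ l ^ gp * G x y t)
    (u : Rd d → ℝ) (h : ∃ l, 0 < l ∧ fracModular univ s G (fun x => u x / l) ≤ 1) :
    fracModular univ s G u ≠ ⊤ := by
  obtain ⟨l, hl, h1⟩ := h
  set L := max l 1 with hL
  have hL1 : 1 ≤ L := le_max_right _ _
  have hLl : 1 ≤ L / l := (one_le_div hl).2 (le_max_left _ _)
  have h2 := frac_scale (s := s) G (fun x y t l hl => (hs x y t l hl).1) (fun x => u x / l) hLl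
  have e : (fun x => u x / l / (L / l)) = fun x => u x / L := by
    funext x; field_simp
  rw [e] at h2
  have h3 : fracModular univ s G (fun x => u x / L) ≤ 1 := by
    refine le_one_of_scale (Real.rpow_pos_of_pos (by linarith) gm) h2 
      (ne_top_of_le_ne_top ENNReal.one_ne_top h1) ?_
    calc _ ≤ (1:ℝ≥0∞).toReal := ENNReal.toReal_mono ENNReal.one_ne_top h1
      _ ≤ _ := by simpa using Real.one_le_rpow hLl hgm.le
  refine ne_top_of_le_ne_top ?_ (frac_scale' G (fun x y t l hl => (hs x y t l hl).2) u hL1)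
  exact ENNReal.mul_ne_top ENNReal.ofReal_ne_top (ne_top_of_le_ne_top ENNReal.one_ne_top h3)

lemma tend_aux {gm pp C : ℝ} (hpp : 0 < pp) (h : pp < gm) :
    Tendsto (fun l : ℝ => l ^ gm - 1 - C * l ^ pp) atTop atTop := by
  have h1 : Tendsto (fun l : ℝ => l ^ pp * (l ^ (gm - pp) - C)) atTop atTop :=
    (tendsto_rpow_atTop hpp).atTop_mul_atTop₀
      (tendsto_atTop_add_const_right _ (-C) (tendsto_rpow_atTop (by linarith)))
  have h2 := tendsto_atTop_add_const_right _ (-1 : ℝ) h1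
  refine h2.congr' ?_
  filter_upwards [eventually_gt_atTop 0] with l hl
  have : l ^ gm = l ^ pp * l ^ (gm - pp) := by rw [← Real.rpow_add hl]; congr 1; ring
  rw [this]; ring

lemma b_bound {d : ℕ} {pm pp C L l dm : ℝ} (p δ b w : Rd d → ℝ) (hpm : 1 < pm)
    (hp_bd : ∀ x, pm ≤ p x ∧ p x ≤ pp) (hdm : 1 < dm) (hδ : ∀ x, dm ≤ δ x) (hL : 1 ≤ L) (hl : 0 < l)
    (hbm : Measurable b) (hδm : Measurable δ) (hC : 0 ≤ C)
    (hb : (∫⁻ x : Rd d, ENNReal.ofReal (|b x / l| ^ (δ x / (δ x - 1)))) < ⊤)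
    (hw : ∫⁻ x, ENNReal.ofReal (|w x| ^ (δ x * p x)) ≤ ENNReal.ofReal C) :
    ∫ x : Rd d, (1 / p x) * b x * |L * w x| ^ p x ≤
      l * ((∫⁻ x : Rd d, ENNReal.ofReal (|b x / l| ^ (δ x / (δ x - 1)))).toReal + C) * L ^ pp := by
  set B := ∫⁻ x : Rd d, ENNReal.ofReal (|b x / l| ^ (δ x / (δ x - 1))) with hB
  have hL0 : 0 < L := by linarith
  refine (le_abs_self _).trans ?_
  rw [← Real.norm_eq_abs]
  refine (norm_integral_le_lintegral_norm _).trans ?_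
  have key : ∫⁻ x : Rd d, ENNReal.ofReal ‖(1 / p x) * b x * |L * w x| ^ p x‖ ≤
      ENNReal.ofReal (l * L ^ pp) * (B + ENNReal.ofReal C) := by
    calc _ ≤ ∫⁻ x, ENNReal.ofReal (l * L ^ pp) * (ENNReal.ofReal (|b x / l| ^ (δ x / (δ x - 1)))
            + ENNReal.ofReal (|w x| ^ (δ x * p x))) := by
          refine lintegral_mono fun x => ?_
          rw [← ENNReal.ofReal_add (by positivity) (by positivity),
            ← ENNReal.ofReal_mul (by positivity)]
          apply ENNReal.ofReal_le_ofReal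
          obtain ⟨hp1, hp2⟩ := hp_bd x
          have hδx : 1 < δ x := hdm.trans_le (hδ x)
          have hpx : 1 < p x := by linarith
          have hconj : (δ x / (δ x - 1)).HolderConjugate (δ x) :=
            (Real.HolderConjugate.conjExponent hδx).symm
          have hY := Real.young_inequality_of_nonneg (abs_nonneg (b x / l))
            (Real.rpow_nonneg (abs_nonneg (w x)) (p x)) hconj
          rw [← Real.rpow_mul (abs_nonneg _), mul_comm (p x)] at hY
          have h1 : |b x / l| ^ (δ x / (δ x - 1)) / (δ x / (δ x - 1)) ≤ |b x / l| ^ (δ x / (δ x - 1)) :=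
            div_le_self (by positivity) hconj.lt.le
          have h2 : |w x| ^ (δ x * p x) / δ x ≤ |w x| ^ (δ x * p x) :=
            div_le_self (by positivity) hδx.le
          have h3 : L ^ p x ≤ L ^ pp := Real.rpow_le_rpow_of_exponent_le hL hp2
          have h4 : ‖(1 / p x) * b x * |L * w x| ^ p x‖ = 1 / p x * |b x| * (L ^ p x * |w x| ^ p x) := by
            rw [norm_mul, norm_mul, Real.norm_eq_abs, Real.norm_eq_abs, Real.norm_eq_abs,
              abs_of_pos (show 0 < 1 / p x by positivity),
              abs_of_nonneg (show 0 ≤ |L * w x| ^ p x by positivity), abs_mul, abs_of_pos hL0,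
              Real.mul_rpow hL0.le (abs_nonneg _)]
          have h5 : |b x| = l * |b x / l| := by
            rw [abs_div, abs_of_pos hl, mul_div_cancel₀ _ hl.ne']
          have h6 : 1 / p x ≤ 1 := by rw [div_le_one (by linarith)]; linarith
          rw [h4, h5]
          calc _ ≤ 1 * (l * |b x / l|) * (L ^ pp * |w x| ^ p x) := by gcongr
            _ = l * L ^ pp * (|b x / l| * |w x| ^ p x) := by ring
            _ ≤ _ := by gcongr; linarith
      _ ≤ _ := by
          have hm : Measurable fun x => ENNReal.ofReal (|b x / l| ^ (δ x / (δ x - 1))) := by fun_prop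
          rw [lintegral_const_mul' _ _ ENNReal.ofReal_ne_top, lintegral_add_left hm]
          gcongr
  have hne : B + ENNReal.ofReal C ≠ ⊤ := ENNReal.add_ne_top.2 ⟨hb.ne, ENNReal.ofReal_ne_top⟩
  refine (ENNReal.toReal_mono (ENNReal.mul_ne_top ENNReal.ofReal_ne_top hne) key).trans (le_of_eq ?_)
  rw [ENNReal.toReal_mul, ENNReal.toReal_ofReal (by positivity), 
    ENNReal.toReal_add hb.ne ENNReal.ofReal_ne_top, ENNReal.toReal_ofReal hC]
  ring

/-- Lemma 7.3: coercivity of the energy functional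
`I(u) = J_{s,G}(u) + ∫ V Ĝ(x,|u|) − ∫ (1/p(x)) b(x)|u|^{p(x)}` on `E`. -/
theorem energy_functional_coercive
    (d : ℕ) (s : ℝ) (a g G : Rd d → Rd d → ℝ → ℝ) (gm gp : ℝ)
    (Ginv : Rd d → ℝ → ℝ) (V b p δ : Rd d → ℝ) (V₀ pm pp dm dp : ℝ)
    (hG : GHyps d univ s a g G gm gp)
    (hg5 : G5Hyps d univ s G Ginv)
    (hBf : Bf univ G)
    (hV : VHyps V V₀)
    (hp_cont : Continuous p) (hδ_cont : Continuous δ)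
    (hp_bd : ∀ x, pm ≤ p x ∧ p x ≤ pp)
    (hδ_bd : ∀ x, dm ≤ δ x ∧ δ x ≤ dp)
    (hpm : 1 < pm) (hppgm : pp < gm) (hgpdm : gp ≤ dm * pm)
    (hdppp : dp * pp ≤ (d : ℝ) * gm / ((d : ℝ) - s * gm))
    (hb_meas : Measurable b)
    (hbL : ∃ l : ℝ, 0 < l ∧
      (∫⁻ x : Rd d, ENNReal.ofReal (|b x / l| ^ (δ x / (δ x - 1)))) < ⊤) :
    ∀ u : ℕ → Rd d → ℝ, (∀ n, memE s G V (u n)) →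
      Tendsto (fun n => normE s G V (u n)) atTop atTop →
      Tendsto (fun n =>
        (fracModular univ s G (u n)).toReal + (wModular G V (u n)).toReal
          - ∫ x : Rd d, (1 / p x) * b x * |u n x| ^ p x) atTop atTop := by
  intro u hu hnorm
  have hfacts := G_facts d s a g G gm gp hG
  obtain ⟨hd2, hs0, hs1, hsd, -, -, -, -, -, -, -, -, -, hgm, hgp, hgq, -⟩ := hG
  obtain ⟨C₁, C₂, hC, hCb⟩ := hBf
  obtain ⟨-, hV0, hV, -⟩ := hV
  obtain ⟨l, hl, hb⟩ := hbL
  have hd : (0:ℝ) < d := by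
    have : (2:ℝ) ≤ d := by exact_mod_cast hd2
    linarith
  set q := (d : ℝ) * gm / ((d : ℝ) - s * gm) with hq
  have hqe : 1 / gm - s / d = 1 / q := by
    have : 0 < (d:ℝ) - s * gm := by linarith
    rw [hq]; field_simp
  have hscale : ∀ x y (t l : ℝ), 1 ≤ l →
      l ^ gm * G x y t ≤ G x y (l * t) ∧ G x y (l * t) ≤ l ^ gp * G x y t :=
    fun x y => (hfacts x y).2.2.2.1
  have hlow : ∀ x y t, C₁ * AA gm gp |t| ≤ G x y t := fun x y t =>
    le_trans (mul_le_mul_of_nonneg_right (hCb x trivial y trivial).1 (AA_nonneg (abs_nonneg _)))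
      ((hfacts x y).2.2.2.2 t)
  have hpp : pm ≤ pp := (hp_bd 0).1.trans (hp_bd 0).2
  have hdm : 1 < dm := by nlinarith
  set C := 4 ^ q * (1 / (V₀ * C₁)) + CS d gm q (1 / C₁) (1 / (V₀ * C₁)) with hCdef
  have hC0 : 0 ≤ C := by
    have := cB_pos d
    rw [hCdef]; unfold CS; positivity
  set B := ∫⁻ x : Rd d, ENNReal.ofReal (|b x / l| ^ (δ x / (δ x - 1))) with hB
  set lam : ℕ → ℝ := fun n =>
    (1 + ((fracModular univ s G (u n)).toReal + (wModular G V (u n)).toReal)) ^ (1/gm) with hlam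
  have hgm0 : 0 < gm := by linarith
  have hmain : ∀ n, normE s G V (u n) ≤ 2 * lam n ∧
      lam n ^ gm - 1 - l * (B.toReal + C) * lam n ^ pp ≤
        (fracModular univ s G (u n)).toReal + (wModular G V (u n)).toReal
          - ∫ x : Rd d, (1 / p x) * b x * |u n x| ^ p x := by
    intro n
    obtain ⟨⟨hum, -, hfr⟩, hwf⟩ := hu n
    have hFf := frac_fin hgm0 G hscale (u n) hfr
    set F := (fracModular univ s G (u n)).toReal with hF
    set W := (wModular G V (u n)).toReal with hW
    have hF0 : 0 ≤ F := ENNReal.toReal_nonneg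
    have hW0 : 0 ≤ W := ENNReal.toReal_nonneg
    have hLdef : lam n = (1 + (F + W)) ^ (1/gm) := rfl
    set L := lam n
    have hL1 : 1 ≤ L := by rw [hLdef]; exact Real.one_le_rpow (by linarith) (by positivity)
    have hL0 : 0 < L := by linarith
    have hLg : L ^ gm = 1 + (F + W) := by
      rw [hLdef, ← Real.rpow_mul (by positivity), one_div_mul_cancel hgm0.ne', Real.rpow_one]
    have hLg0 : 0 < L ^ gm := by positivity
    have hf1 : fracModular univ s G (fun x => u n x / L) ≤ 1 :=
      le_one_of_scale hLg0 (frac_scale G (fun x y t l hl => (hscale x y t l hl).1) (u n) hL1) hFf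
        (by linarith)
    have hw1 : wModular G V (fun x => u n x / L) ≤ 1 :=
      le_one_of_scale hLg0 (w_scale G V (fun x => hV0.le.trans (hV x))
        (fun x y t l hl => (hscale x y t l hl).1) (u n) hL1) hwf.ne (by linarith)
    constructor
    · have h1 : gagliardo univ s G (u n) ≤ L :=
        csInf_le ⟨0, fun z hz => hz.1.le⟩ ⟨hL0, hf1⟩
      have h2 : wNorm G V (u n) ≤ L :=
        csInf_le ⟨0, fun z hz => hz.1.le⟩ ⟨hL0, hw1⟩
      unfold normE; linarith
    · have he : ∀ x, gp ≤ δ x * p x ∧ δ x * p x ≤ q := by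
        intro x
        obtain ⟨hp1, hp2⟩ := hp_bd x
        obtain ⟨hδ1, hδ2⟩ := hδ_bd x
        constructor
        · exact hgpdm.trans (mul_le_mul hδ1 hp1 (by linarith) (by linarith))
        · exact le_trans (mul_le_mul hδ2 hp2 (by linarith) (by linarith)) hdppp
      have hE := emb hd hgm.le hgp hs0 (hgp.trans hgq.le) hqe hC hV0 G V hV hlow
        (fun x => u n x / L) (hum.div_const L) hf1 hw1 (fun x => δ x * p x) he
      have hI := b_bound p δ b (fun x => u n x / L) hpm hp_bd hdm (fun x => (hδ_bd x).1) hL1 hl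
        hb_meas hδ_cont.measurable hC0 hb hE
      have e : ∀ x, L * (u n x / L) = u n x := fun x => mul_div_cancel₀ _ hL0.ne'
      simp only [e] at hI
      rw [hLg]
      linarith
  have hlamT : Tendsto lam atTop atTop := by
    have h1 : Tendsto (fun n => normE s G V (u n) / 2) atTop atTop :=
      hnorm.atTop_div_const (by norm_num)
    refine tendsto_atTop_mono (fun n => ?_) h1
    have := (hmain n).1
    linarith
  exact tendsto_atTop_mono (fun n => (hmain n).2)
    ((tend_aux (C := l * (B.toReal + C)) (by linarith) hppgm).comp hlamT)
end
end
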